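/- arXiv:2008.00246 — 3 statements merged into one kernel-verified Lean document; each statement's English description precedes it below -/
import Mathlib

section
/- (Patil) Let n₀,...,n_p be a minimal almost arithmetic sequence: n₀,...,n_{p−1} form an arithmetic sequence (n_i = a + i·d for 0 ≤ i ≤ p−1), n_p is an arbitrary further positive integer, gcd(n₀,...,n_p) = 1, and n₀,...,n_p minimally generate the numerical semigroup Γ(n₀,...,n_p). Then the defining ideal 𝔭(n₀,...,n_p) ⊆ k[x₀,...,x_p] is a set-theoretic complete intersection: there exist p polynomials f₁,...,f_p with 𝔭(n₀,...,n_p) equal to the radical of (f₁,...,f_p). -/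
open Polynomial

universe u

/-- A primitive vector `(x, y, z)` orthogonal to `(a, d, n)` extends to a pair generating the
lattice of integer vectors orthogonal to `(a, d, n)`. -/
theorem exists_complement_of_primitive {a d n x y z : ℤ}
    (hh : ∃ g₁ g₂ g₃ : ℤ, g₁ * a + g₂ * d + g₃ * n = 1)
    (hv : ∃ w₁ w₂ w₃ : ℤ, w₁ * x + w₂ * y + w₃ * z = 1)
    (h : x * a + y * d + z * n = 0) :
    ∃ x' y' z' : ℤ, x' * a + y' * d + z' * n = 0 ∧
      ∀ u v w : ℤ, u * a + v * d + w * n = 0 →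
        ∃ s t : ℤ, u = s * x + t * x' ∧ v = s * y + t * y' ∧ w = s * z + t * z' := by
  obtain ⟨g₁, g₂, g₃, hg⟩ := hh
  obtain ⟨w₁, w₂, w₃, hw⟩ := hv
  refine ⟨w₂ * n - w₃ * d, w₃ * a - w₁ * n, w₁ * d - w₂ * a, by ring, fun u v w huv => ?_⟩
  -- the cross product of two vectors of the lattice is a multiple of `(a, d, n)`
  set φ := g₁ * (y * w - z * v) + g₂ * (z * u - x * w) + g₃ * (x * v - y * u) with hφ
  have c₁ : y * w - z * v = φ * a := by
    rw [hφ]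
    linear_combination (-(y * w - z * v)) * hg + (g₂ * w - g₃ * v) * h - (g₂ * z - g₃ * y) * huv
  have c₂ : z * u - x * w = φ * d := by
    rw [hφ]
    linear_combination (-(z * u - x * w)) * hg + (g₃ * u - g₁ * w) * h - (g₃ * x - g₁ * z) * huv
  have c₃ : x * v - y * u = φ * n := by
    rw [hφ]
    linear_combination (-(x * v - y * u)) * hg + (g₁ * v - g₂ * u) * h - (g₁ * y - g₂ * x) * huv
  refine ⟨w₁ * u + w₂ * v + w₃ * w, -φ, ?_, ?_, ?_⟩
  · linear_combination (-u) * hw - w₂ * c₃ + w₃ * c₂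
  · linear_combination (-v) * hw - w₃ * c₁ + w₁ * c₃
  · linear_combination (-w) * hw - w₁ * c₂ + w₂ * c₁

theorem exists_bezout_three (x y z : ℤ) :
    ∃ w₁ w₂ w₃ : ℤ, w₁ * x + w₂ * y + w₃ * z = Int.gcd x (Int.gcd y z) := by
  refine ⟨Int.gcdA x (Int.gcd y z), Int.gcdB x (Int.gcd y z) * Int.gcdA y z,
    Int.gcdB x (Int.gcd y z) * Int.gcdB y z, ?_⟩
  have h₁ := Int.gcd_eq_gcd_ab x (Int.gcd y z)
  have h₂ := Int.gcd_eq_gcd_ab y z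
  rw [h₁]
  linear_combination (-Int.gcdB x (Int.gcd y z)) * h₂

theorem exists_bezout_of_coprime {a d n : ℕ}
    (hgcd : ∀ e : ℕ, e ∣ a → e ∣ d → e ∣ n → e = 1) :
    ∃ g₁ g₂ g₃ : ℤ, g₁ * a + g₂ * d + g₃ * n = 1 := by
  have h := exists_bezout_three a d n
  have h1 : Int.gcd a (Int.gcd d n) = 1 := by
    apply hgcd
    · exact_mod_cast Int.gcd_dvd_left (a := (a : ℤ)) (b := Int.gcd d n)
    · exact_mod_cast (Int.gcd_dvd_right (a := (a : ℤ)) (b := Int.gcd d n)).trans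
        (Int.gcd_dvd_left (a := (d : ℤ)) (b := n))
    · exact_mod_cast (Int.gcd_dvd_right (a := (a : ℤ)) (b := Int.gcd d n)).trans
        (Int.gcd_dvd_right (a := (d : ℤ)) (b := n))
  rw [h1] at h
  exact_mod_cast h

/-- A basis of the lattice orthogonal to `(a, d, n)` adapted to the cone
`0 ≤ y ≤ r * x` of exponents of monomials on the rational normal curve of degree `r`. -/
theorem exists_adapted_lattice_basis {r a d n : ℕ} (hr : 0 < r) (ha : 0 < a) (hn : 0 < n)
    (hgcd : ∀ e : ℕ, e ∣ a → e ∣ d → e ∣ n → e = 1) :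
    ∃ (c D j b e : ℕ) (D' : ℤ), 0 < c ∧ 0 < b ∧ e < c ∧ j ≤ r * D ∧
      (r * D - j : ℤ) < r * D' + b ∧ D * a + j * d = c * n ∧
      D' * a = b * d + e * n ∧
      ∀ u v w : ℤ, u * a + v * d + w * n = 0 →
        ∃ s t : ℤ, u = s * D + t * D' ∧ v = s * j + t * (-b) ∧ w = s * (-c) + t * (-e) := by
  classical
  have hex : ∃ c : ℕ, 0 < c ∧ ∃ D j : ℕ, j ≤ r * D ∧ D * a + j * d = c * n :=
    ⟨a, ha, n, 0, Nat.zero_le _, by ring⟩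
  obtain ⟨c, ⟨hc, D, j, hj, hw⟩, hmin⟩ : ∃ c : ℕ,
      (0 < c ∧ ∃ D j : ℕ, j ≤ r * D ∧ D * a + j * d = c * n) ∧
      ∀ c' : ℕ, 0 < c' → c' < c → ¬ ∃ D j : ℕ, j ≤ r * D ∧ D * a + j * d = c' * n :=
    ⟨Nat.find hex, Nat.find_spec hex, fun c' h0 h1 h2 => Nat.find_min hex h1 ⟨h0, h2⟩⟩
  have hminZ : ∀ D' j' c' : ℤ, 0 < c' → c' < c → D' * a + j' * d = c' * n → 0 ≤ j' →
      r * D' < j' := by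
    intro D' j' c' h0 h1 h2 h3
    by_contra! h4
    have hD : 0 ≤ D' := by
      by_contra! hneg
      have : (r : ℤ) * D' < 0 := mul_neg_of_pos_of_neg (by exact_mod_cast hr) hneg
      omega
    lift D' to ℕ using hD
    lift j' to ℕ using h3
    lift c' to ℕ using h0.le
    exact hmin c' (by exact_mod_cast h0) (by exact_mod_cast h1)
      ⟨D', j', by exact_mod_cast h4, by exact_mod_cast h2⟩
  have hposw : ∀ D' j' c' : ℤ, 0 < c' → D' * a + j' * d = c' * n → j' ≤ 0 → 0 < r * D' - j' := by
    intro D' j' c' h0 h2 h3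
    have h5 : (a : ℤ) * (r * D' - j') = r * (c' * n) - (a + r * d) * j' := by
      linear_combination (r : ℤ) * h2
    have h6 : 0 < (r : ℤ) * (c' * n) := by positivity
    have h7 : (a + r * d : ℤ) * j' ≤ 0 := mul_nonpos_of_nonneg_of_nonpos (by positivity) h3
    have h8 : 0 < (a : ℤ) * (r * D' - j') := by rw [h5]; linarith
    exact pos_of_mul_pos_right h8 (by positivity)
  have hwZ : (D : ℤ) * a + j * d = c * n := by exact_mod_cast hw
  have hprim : Int.gcd D (Int.gcd j (-c : ℤ)) = 1 := by
    set g := Int.gcd D (Int.gcd j (-c : ℤ)) with hg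
    have h1 : g ∣ D := by
      exact_mod_cast Int.gcd_dvd_left (a := (D : ℤ)) (b := Int.gcd j (-c : ℤ))
    have h2 : (g : ℤ) ∣ Int.gcd j (-c : ℤ) := Int.gcd_dvd_right ..
    have h3 : g ∣ j := by exact_mod_cast h2.trans (Int.gcd_dvd_left ..)
    have h4 : g ∣ c := by
      have := h2.trans (Int.gcd_dvd_right ..)
      rw [dvd_neg] at this
      exact_mod_cast this
    obtain ⟨D₀, hD₀⟩ := h1
    obtain ⟨j₀, hj₀⟩ := h3
    obtain ⟨c₀, hc₀⟩ := h4
    have hgpos : 0 < g := Nat.pos_of_ne_zero fun h => by rw [h, zero_mul] at hc₀; omega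
    have hc₀pos : 0 < c₀ := Nat.pos_of_ne_zero fun h => by rw [h, mul_zero] at hc₀; omega
    by_contra hne
    refine hmin c₀ hc₀pos ?_ ⟨D₀, j₀, ?_, ?_⟩
    · have : 2 ≤ g := by omega
      rw [hc₀]; nlinarith
    · apply Nat.le_of_mul_le_mul_left _ hgpos
      calc g * j₀ = j := hj₀.symm
        _ ≤ r * D := hj
        _ = g * (r * D₀) := by rw [hD₀]; ring
    · apply Nat.eq_of_mul_eq_mul_left hgpos
      rw [hD₀, hj₀, hc₀] at hw
      linarith
  have hprim' := exists_bezout_three D j (-c)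
  rw [hprim] at hprim'
  have hh : ∃ g₁ g₂ g₃ : ℤ, g₁ * a + g₂ * d + g₃ * n = 1 := exists_bezout_of_coprime hgcd
  obtain ⟨x₀, y₀, z₀, horth₀, hgen₀⟩ := exists_complement_of_primitive hh
    (by exact_mod_cast hprim') (show (D : ℤ) * a + j * d + (-c) * n = 0 by linarith)
  obtain ⟨x, y, e, horth, hec, hgen⟩ : ∃ (x y : ℤ) (e : ℕ), x * a + y * d = e * n ∧ e < c ∧
      ∀ u v w : ℤ, u * a + v * d + w * n = 0 →
        ∃ s t : ℤ, u = s * D + t * x ∧ v = s * j + t * y ∧ w = s * (-c) + t * (-e) := by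
    have hcZ : (0 : ℤ) < c := by exact_mod_cast hc
    have hm0 := Int.emod_nonneg (-z₀) hcZ.ne'
    have hm1 := Int.emod_lt_of_pos (-z₀) hcZ
    have hdm := Int.emod_add_mul_ediv (-z₀) c
    set q := (-z₀) / (c : ℤ)
    obtain ⟨e, he⟩ := Int.eq_ofNat_of_zero_le hm0
    rw [he] at hm1 hdm
    refine ⟨x₀ - q * D, y₀ - q * j, e, ?_, by exact_mod_cast hm1, fun u v w huv => ?_⟩
    · linear_combination horth₀ - q * hwZ - n * hdm
    · obtain ⟨s, t, h1, h2, h3⟩ := hgen₀ u v w huv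
      exact ⟨s + t * q, t, by rw [h1]; ring, by rw [h2]; ring,
        by rw [h3]; linear_combination t * hdm⟩
  rcases Nat.eq_zero_or_pos e with rfl | he
  · obtain ⟨x, b, horth, hb, hgen⟩ : ∃ (x : ℤ) (b : ℕ), x * a = b * d ∧ 0 < b ∧
      ∀ u v w : ℤ, u * a + v * d + w * n = 0 →
        ∃ s t : ℤ, u = s * D + t * x ∧ v = s * j + t * (-b) ∧ w = s * (-c) := by
      have hy : y ≠ 0 := by
        rintro rfl
        obtain ⟨s, t, -, h2, h3⟩ := hgen d (-a) 0 (by ring)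
        have hs : s = 0 := by
          have : s * (c : ℤ) = 0 := by push_cast at h3; linarith
          rcases mul_eq_zero.mp this with h | h
          · exact h
          · exact absurd h (by exact_mod_cast hc.ne')
        rw [hs] at h2
        have : (a : ℤ) = 0 := by linarith
        exact ha.ne' (by exact_mod_cast this)
      rcases lt_or_gt_of_ne hy with hy | hy
      · obtain ⟨b, hb⟩ := Int.eq_ofNat_of_zero_le (show 0 ≤ -y by omega)
        refine ⟨x, b, ?_, by omega, fun u v w huv => ?_⟩
        · rw [← hb]; push_cast at horth; linarith
        · obtain ⟨s, t, h1, h2, h3⟩ := hgen u v w huv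
          exact ⟨s, t, h1, by rw [h2, ← hb]; ring, by rw [h3]; simp⟩
      · obtain ⟨b, hb⟩ := Int.eq_ofNat_of_zero_le hy.le
        refine ⟨-x, b, ?_, by omega, fun u v w huv => ?_⟩
        · rw [← hb]; push_cast at horth; linarith
        · obtain ⟨s, t, h1, h2, h3⟩ := hgen u v w huv
          exact ⟨s, -t, by rw [h1]; ring, by rw [h2, ← hb]; ring, by rw [h3]; simp⟩
    have hx : 0 ≤ x := by
      have h : 0 ≤ x * a := by rw [horth]; positivity
      exact nonneg_of_mul_nonneg_left h (by exact_mod_cast ha)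
    have hA : 0 < r * x + b := by positivity
    have hm0 := Int.emod_nonneg (r * D - j : ℤ) hA.ne'
    have hm1 := Int.emod_lt_of_pos (r * D - j : ℤ) hA
    have hdm := Int.emod_add_mul_ediv (r * D - j : ℤ) (r * x + b)
    set q := (r * D - j : ℤ) / (r * x + b) with hq
    have hq0 : 0 ≤ q := Int.ediv_nonneg (by
      have : (j : ℤ) ≤ r * D := by exact_mod_cast hj
      linarith) hA.le
    have hj' : 0 ≤ j + q * b := by positivity
    have hred : (r * D - j : ℤ) % (r * x + b) = r * (D - q * x) - (j + q * b) := by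
      linear_combination hdm
    rw [hred] at hm0 hm1
    have hD' : 0 ≤ D - q * x := by
      have : 0 ≤ (r : ℤ) * (D - q * x) := by linarith
      exact nonneg_of_mul_nonneg_right this (by exact_mod_cast hr)
    obtain ⟨D₁, hD₁⟩ := Int.eq_ofNat_of_zero_le hD'
    obtain ⟨j₁, hj₁⟩ := Int.eq_ofNat_of_zero_le hj'
    rw [hD₁, hj₁] at hm0 hm1
    refine ⟨c, D₁, j₁, b, 0, x, hc, hb, hc, by zify; linarith, hm1, ?_, by simpa using horth, ?_⟩
    · zify
      rw [← hD₁, ← hj₁]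
      linear_combination hwZ - q * horth
    · intro u v w huv
      obtain ⟨s, t, h1, h2, h3⟩ := hgen u v w huv
      refine ⟨s, t + s * q, ?_, ?_, by rw [h3]; simp⟩
      · rw [h1, ← hD₁]; ring
      · rw [h2, ← hj₁]; ring
  · -- vectors with negative height strictly between `-c` and `0` lie outside the cone
    have key : ∀ (x y : ℤ) (e : ℕ), 0 < e → e < c → x * a + y * d = e * n → 0 < r * x - y →
        ∃ b : ℕ, 0 < b ∧ y = -b ∧ (r * D - j : ℤ) < r * x + b := by
      intro x y e he hec horth hA
      have hy : y < 0 := by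
        by_contra! hy
        have := hminZ x y e (by exact_mod_cast he) (by exact_mod_cast hec) horth hy
        linarith
      obtain ⟨b, hb⟩ := Int.eq_ofNat_of_zero_le (show 0 ≤ -y by omega)
      refine ⟨b, by omega, by omega, ?_⟩
      have := hminZ (D - x) (j - y) (c - e) (by omega) (by omega)
        (by linear_combination hwZ - horth) (by omega)
      rw [← hb]
      linarith
    obtain ⟨x, y, e, he, hec, horth, hA, hgen⟩ : ∃ (x y : ℤ) (e : ℕ), 0 < e ∧ e < c ∧
        x * a + y * d = e * n ∧ 0 < r * x - y ∧
        (∀ u v w : ℤ, u * a + v * d + w * n = 0 →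
          ∃ s t : ℤ, u = s * D + t * x ∧ v = s * j + t * y ∧ w = s * (-c) + t * (-e)) := by
      by_cases hA : 0 < r * x - y
      · exact ⟨x, y, e, he, hec, horth, hA, hgen⟩
      · have hA' : r * x - y < 0 := by
          by_contra! h
          have hy : 0 < y := by
            by_contra! hy
            exact hA (hposw x y e (by exact_mod_cast he) horth hy)
          have := hminZ x y e (by exact_mod_cast he) (by exact_mod_cast hec) horth hy.le
          linarith
        have hjZ : (j : ℤ) ≤ r * D := by exact_mod_cast hj
        refine ⟨D - x, j - y, c - e, by omega, by omega, ?_, by linarith, fun u v w huv => ?_⟩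
        · rw [Nat.cast_sub hec.le]; linear_combination hwZ - horth
        · obtain ⟨s, t, h1, h2, h3⟩ := hgen u v w huv
          refine ⟨s + t, -t, by rw [h1]; ring, by rw [h2]; ring, ?_⟩
          rw [h3, Nat.cast_sub hec.le]; ring
    obtain ⟨b, hb, rfl, hlt⟩ := key x y e he hec horth hA
    exact ⟨c, D, j, b, e, x, hc, hb, hec, hj, hlt, hw, by linarith, hgen⟩

theorem ker_eq_radical_of_forall_zero {k : Type u} [Field k] {ι κ : Type}
    (n : ι → ℕ) (f : κ → MvPolynomial ι k)
    (hker : ∀ l, MvPolynomial.aeval (fun i => (X : k[X]) ^ n i) (f l) = 0)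
    (hzero : ∀ (L : Type u) [Field L] [Algebra k L] (x : ι → L),
      (∀ l, MvPolynomial.aeval x (f l) = 0) → ∃ t : L, ∀ i, x i = t ^ n i) :
    RingHom.ker (MvPolynomial.aeval (R := k) fun i => (X : k[X]) ^ n i).toRingHom =
      (Ideal.span (Set.range f)).radical := by
  apply le_antisymm
  · intro g hg
    have hg : MvPolynomial.aeval (fun i => (X : k[X]) ^ n i) g = 0 := hg
    rw [Ideal.radical_eq_sInf, Submodule.mem_sInf]
    rintro Q ⟨hQ, hQp⟩
    have : Ideal.IsPrime Q := hQp
    let ψ : MvPolynomial ι k →ₐ[k] FractionRing (MvPolynomial ι k ⧸ Q) :=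
      (IsScalarTower.toAlgHom k (MvPolynomial ι k ⧸ Q) _).comp (Ideal.Quotient.mkₐ k Q)
    have hψ : ∀ q, ψ q = 0 ↔ q ∈ Q := by
      intro q
      change algebraMap (MvPolynomial ι k ⧸ Q) (FractionRing (MvPolynomial ι k ⧸ Q))
        (Ideal.Quotient.mk Q q) = 0 ↔ _
      rw [FaithfulSMul.algebraMap_eq_zero_iff, Ideal.Quotient.eq_zero_iff_mem]
    have hψa : ψ = MvPolynomial.aeval (fun i => ψ (MvPolynomial.X i)) :=
      MvPolynomial.aeval_unique ψ
    obtain ⟨t, ht⟩ := hzero _ (fun i => ψ (MvPolynomial.X i)) fun l => by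
      rw [← hψa, hψ]
      exact hQ (Ideal.subset_span ⟨l, rfl⟩)
    rw [← hψ, hψa, funext ht]
    have hcomp : (MvPolynomial.aeval (R := k) fun i => t ^ n i) =
        (Polynomial.aeval t).comp (MvPolynomial.aeval (R := k) fun i => (X : k[X]) ^ n i) := by
      ext i; simp
    rw [hcomp, AlgHom.comp_apply, hg, map_zero]
  · have hp : (RingHom.ker
        (MvPolynomial.aeval (R := k) fun i => (X : k[X]) ^ n i).toRingHom).IsPrime :=
      RingHom.ker_isPrime _
    rw [hp.radical_le_iff, Ideal.span_le]
    rintro _ ⟨l, rfl⟩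
    exact hker l

/-- A monomial of degree `D` and index weight `j` in `x 0, …, x r`, for `j ≤ r * D`. -/
def weightedMonomial {R : Type*} [CommRing R] (x : ℕ → R) (r : ℕ) : ℕ → ℕ → R
  | 0, _ => 1
  | D + 1, j => if r ≤ j then x r * weightedMonomial x r D (j - r)
      else x j * weightedMonomial x r D 0

theorem map_weightedMonomial {R S F : Type*} [CommRing R] [CommRing S] [FunLike F R S]
    [RingHomClass F R S] (φ : F) (x : ℕ → R) (r D j : ℕ) :
    φ (weightedMonomial x r D j) = weightedMonomial (fun l => φ (x l)) r D j := by
  induction D generalizing j with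
  | zero => simp [weightedMonomial]
  | succ D ih =>
    simp only [weightedMonomial]
    split_ifs <;> simp [ih]

theorem weightedMonomial_of_geometric {R : Type*} [CommRing R] {x : ℕ → R} {r : ℕ} {q : R}
    (hx : ∀ l ≤ r, x l = x 0 * q ^ l) {D j : ℕ} (hj : j ≤ r * D) :
    weightedMonomial x r D j = x 0 ^ D * q ^ j := by
  induction D generalizing j with
  | zero => simp [weightedMonomial, show j = 0 by omega]
  | succ D ih =>
    rw [Nat.mul_succ] at hj
    simp only [weightedMonomial]
    split_ifs with h
    · rw [ih (by omega), hx r le_rfl, ← Nat.add_sub_cancel' h, Nat.add_sub_cancel_left]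
      ring
    · rw [ih (Nat.zero_le _), hx j (by omega)]
      ring

theorem weightedMonomial_eq_zero {R : Type*} [CommRing R] {x : ℕ → R} {r : ℕ}
    (hx : ∀ l < r, x l = 0) {D j : ℕ} (hj : j < r * D) :
    weightedMonomial x r D j = 0 := by
  induction D generalizing j with
  | zero => omega
  | succ D ih =>
    rw [Nat.mul_succ] at hj
    simp only [weightedMonomial]
    split_ifs with h
    · rw [ih (by omega), mul_zero]
    · rw [hx j (by omega), zero_mul]

theorem weightedMonomial_mul_self {R : Type*} [CommRing R] (x : ℕ → R) (r D : ℕ) :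
    weightedMonomial x r D (r * D) = x r ^ D := by
  induction D with
  | zero => simp [weightedMonomial]
  | succ D ih =>
    simp only [weightedMonomial, Nat.mul_succ]
    rw [if_pos (by omega), Nat.add_sub_cancel, ih, pow_succ']

/-- The equations cutting out the cone over the rational normal curve set-theoretically. -/
def normalCurveEquation {R : Type*} [CommRing R] (x : ℕ → R) (i : ℕ) : R :=
  ∑ α ∈ Finset.range (i + 1), (-1) ^ α * (i.choose α : R) * x (i + 1) ^ (i - α) * x i ^ α * x α

theorem map_normalCurveEquation {R S F : Type*} [CommRing R] [CommRing S] [FunLike F R S]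
    [RingHomClass F R S] (φ : F) (x : ℕ → R) (i : ℕ) :
    φ (normalCurveEquation x i) = normalCurveEquation (fun l => φ (x l)) i := by
  simp [normalCurveEquation]

theorem normalCurveEquation_of_geometric {R : Type*} [CommRing R] {x : ℕ → R} {i : ℕ} {q : R}
    (hx : ∀ l ≤ i, x l = x 0 * q ^ l) :
    normalCurveEquation x i = x 0 * (x (i + 1) - x 0 * q ^ (i + 1)) ^ i := by
  rw [sub_eq_neg_add, add_pow, Finset.mul_sum, normalCurveEquation]
  refine Finset.sum_congr rfl fun α hα => ?_
  rw [hx i le_rfl, hx α (by simpa [Nat.lt_succ_iff] using hα), neg_pow (x 0 * _)]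
  ring

theorem geometric_of_normalCurveEquation {L : Type*} [Field L] {x : ℕ → L} {r : ℕ}
    (h : ∀ i, 1 ≤ i → i < r → normalCurveEquation x i = 0) (h0 : x 0 ≠ 0) :
    ∀ l ≤ r, x l = x 0 * (x 1 / x 0) ^ l := by
  intro l
  induction l using Nat.strong_induction_on with
  | _ l ih =>
    intro hl
    match l, ih, hl with
    | 0, _, _ => simp
    | 1, _, _ => field_simp
    | i + 2, ih, hl =>
      have h1 := h (i + 1) (by omega) (by omega)
      rw [normalCurveEquation_of_geometric (q := x 1 / x 0)
        fun l hl' => ih l (by omega) (by omega)] at h1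
      exact sub_eq_zero.mp (eq_zero_of_pow_eq_zero ((mul_eq_zero.mp h1).resolve_left h0))

theorem eq_zero_of_normalCurveEquation {L : Type*} [Field L] {x : ℕ → L} {r : ℕ}
    (h : ∀ i, 1 ≤ i → i < r → normalCurveEquation x i = 0) (h0 : x 0 = 0) :
    ∀ l < r, x l = 0 := by
  intro l
  induction l using Nat.strong_induction_on with
  | _ l ih =>
    intro hl
    rcases Nat.eq_zero_or_pos l with rfl | hpos
    · exact h0
    have h1 := h l hpos hl
    rw [normalCurveEquation, Finset.sum_range_succ, Finset.sum_eq_zero fun α hα => by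
      rw [ih α (Finset.mem_range.mp hα) (by have := Finset.mem_range.mp hα; omega), mul_zero]] at h1
    have h2 : x l ^ l * x l = 0 := by simpa [hpos.ne'] using h1
    rw [← pow_succ] at h2
    exact eq_zero_of_pow_eq_zero h2

/-- The polynomial obtained from `(1 - x₀ ^ (-D') * q ^ b * y ^ e) ^ (c * r)`, with
`q = x₁ / x₀`, by reducing modulo `y ^ c = x₀ ^ D * q ^ j` and clearing denominators. -/
def reducedPower {R : Type*} [CommRing R] (x : ℕ → R) (y : R) (r c D j b e : ℕ) (D' : ℤ) : R :=
  ∑ l ∈ Finset.range (c * r + 1), (-1) ^ l * ((c * r).choose l : R) *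
    weightedMonomial x r
      ((r * D' + b) * c - (r * D - j) * e - D' * l + D * (e * l / c : ℕ) : ℤ).toNat
      (b * l + j * (e * l / c)) * y ^ (e * l % c)

theorem map_reducedPower {R S F : Type*} [CommRing R] [CommRing S] [FunLike F R S]
    [RingHomClass F R S] (φ : F) (x : ℕ → R) (y : R) (r c D j b e : ℕ) (D' : ℤ) :
    φ (reducedPower x y r c D j b e D') =
      reducedPower (fun l => φ (x l)) (φ y) r c D j b e D' := by
  simp [reducedPower, map_weightedMonomial]

section

variable {r c D j b e : ℕ} {D' : ℤ}

theorem reducedPower_exponent_bound (hr : 0 < r) (hec : e < c) (hj : j ≤ r * D)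
    (hlt : (r * D - j : ℤ) < r * D' + b) {l : ℕ} (hl : l ≤ c * r) :
    ∃ E : ℕ, (E : ℤ) = (r * D' + b) * c - (r * D - j) * e - D' * l + D * (e * l / c : ℕ) ∧
      b * l + j * (e * l / c) ≤ r * E ∧
      (l < c * r → b * l + j * (e * l / c) < r * E) ∧
      (l = c * r → b * l + j * (e * l / c) = r * E) := by
  have hdm := Nat.div_add_mod (e * l) c
  have hm1 := Nat.mod_lt (e * l) (show 0 < c by omega)
  set κ := e * l / c
  zify at hdm hm1 hj hl hec hr
  have hm0 : (0 : ℤ) ≤ (e * l % c : ℤ) := Int.emod_nonneg _ (by omega)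
  have hel : (e : ℤ) * l ≤ e * (c * r) := by gcongr
  have hu0 : 0 ≤ (e * r - κ : ℤ) := by
    by_contra! h
    nlinarith
  have hum : (e * r - κ : ℤ) ≤ c * r - l := by
    by_contra! h
    nlinarith
  have hdiff : (r : ℤ) * ((r * D' + b) * c - (r * D - j) * e - D' * l + D * κ) - (b * l + j * κ) =
      (r * D' + b) * (c * r - l) - (r * D - j) * (e * r - κ) := by ring
  set Z : ℤ := (r * D' + b) * c - (r * D - j) * e - D' * l + D * κ
  have hge : (c * r - l : ℤ) ≤ r * Z - (b * l + j * κ) := by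
    rw [hdiff]
    have h1 : (r * D - j : ℤ) * (e * r - κ) ≤ (r * D - j) * (c * r - l) :=
      mul_le_mul_of_nonneg_left hum (by linarith)
    nlinarith
  have hZ : 0 ≤ Z := by
    have : 0 ≤ (r : ℤ) * Z := by
      have : (0 : ℤ) ≤ b * l + j * κ := by positivity
      linarith
    exact nonneg_of_mul_nonneg_right this hr
  obtain ⟨E, hE⟩ := Int.eq_ofNat_of_zero_le hZ
  rw [hE] at hge hdiff
  refine ⟨E, hE.symm, by zify; linarith, fun h => by zify at h ⊢; linarith, fun h => ?_⟩
  zify at h ⊢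
  have hu : (e * r - κ : ℤ) = 0 := by linarith
  rw [hu, ← h] at hdiff
  linarith

theorem reducedPower_of_geometric {L : Type*} [Field L] {x : ℕ → L} {y q : L}
    (hr : 0 < r) (hec : e < c) (hj : j ≤ r * D) (hlt : (r * D - j : ℤ) < r * D' + b)
    (hx : ∀ l ≤ r, x l = x 0 * q ^ l) (h0 : x 0 ≠ 0) (hy : y ^ c = x 0 ^ D * q ^ j) :
    reducedPower x y r c D j b e D' =
      x 0 ^ ((r * D' + b) * c - (r * D - j) * e : ℤ) *
        (1 - x 0 ^ (-D') * q ^ b * y ^ e) ^ (c * r) := by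
  rw [sub_eq_neg_add 1, add_pow, Finset.mul_sum, reducedPower]
  refine Finset.sum_congr rfl fun l hl => ?_
  obtain ⟨E, hE, hle, -, -⟩ := reducedPower_exponent_bound hr hec hj hlt
    (show l ≤ c * r by simpa [Nat.lt_succ_iff] using hl)
  have hyl : y ^ (e * l) = x 0 ^ (D * (e * l / c)) * q ^ (j * (e * l / c)) * y ^ (e * l % c) := by
    conv_lhs => rw [← Nat.div_add_mod (e * l) c, pow_add, pow_mul, hy]
    ring
  rw [← hE, Int.toNat_natCast, weightedMonomial_of_geometric hx hle, ← zpow_natCast (x 0) E, hE,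
    zpow_add₀ h0, sub_eq_add_neg _ (D' * _), zpow_add₀ h0, neg_pow (_ * _), mul_pow, mul_pow, ← pow_mul y,
    hyl, ← zpow_natCast (x 0 ^ (-D')), ← zpow_mul, neg_mul]
  have : x 0 ^ ((D : ℤ) * ((e * l / c : ℕ) : ℤ)) = x 0 ^ (D * (e * l / c)) := by
    rw [← Nat.cast_mul, zpow_natCast]
  rw [this]
  ring

theorem eq_zero_of_reducedPower {L : Type*} [Field L] {x : ℕ → L} {y : L}
    (hr : 0 < r) (hb : 0 < b) (hec : e < c) (hj : j ≤ r * D)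
    (hlt : (r * D - j : ℤ) < r * D' + b) (hx : ∀ l < r, x l = 0)
    (h : reducedPower x y r c D j b e D' = 0) : x r = 0 := by
  obtain ⟨E, hE, -, -, hlast⟩ := reducedPower_exponent_bound hr hec hj hlt le_rfl
  rw [reducedPower, Finset.sum_range_succ, Finset.sum_eq_zero, ← hE, Int.toNat_natCast,
    hlast rfl, weightedMonomial_mul_self] at h
  · have hmod : e * (c * r) % c = 0 := by
      rw [mul_left_comm]; exact Nat.mul_mod_right _ _
    have hE0 : E ≠ 0 := by
      rintro rfl
      have := hlast rfl
      have hc : 0 < c := by omega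
      have : 0 < b * (c * r) := by positivity
      omega
    simpa [hmod, hE0] using h
  · intro l hl
    obtain ⟨E, hE, -, hlt', -⟩ := reducedPower_exponent_bound hr hec hj hlt
      (Finset.mem_range.mp hl).le
    rw [← hE, Int.toNat_natCast, weightedMonomial_eq_zero hx (hlt' (Finset.mem_range.mp hl))]
    simp

end

/-- A point of the torus on which two generators of the lattice orthogonal to `(a, d, n)` are
trivial lies on the monomial curve `t ↦ (t ^ a, t ^ d, t ^ n)`. -/
theorem exists_parameter_of_lattice_generators {L : Type*} [Field L] {x q y : L}
    (hx : x ≠ 0) (hq : q ≠ 0) (hy : y ≠ 0) {a d n : ℕ}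
    (hgcd : ∃ g₁ g₂ g₃ : ℤ, g₁ * a + g₂ * d + g₃ * n = 1) {u₁ v₁ w₁ u₂ v₂ w₂ : ℤ}
    (h₁ : x ^ u₁ * q ^ v₁ * y ^ w₁ = 1) (h₂ : x ^ u₂ * q ^ v₂ * y ^ w₂ = 1)
    (hgen : ∀ u v w : ℤ, u * a + v * d + w * n = 0 →
      ∃ s t : ℤ, u = s * u₁ + t * u₂ ∧ v = s * v₁ + t * v₂ ∧ w = s * w₁ + t * w₂) :
    ∃ t : L, x = t ^ a ∧ q = t ^ d ∧ y = t ^ n := by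
  have htriv : ∀ u v w : ℤ, u * a + v * d + w * n = 0 → x ^ u * q ^ v * y ^ w = 1 := by
    intro u v w h
    obtain ⟨s, t, rfl, rfl, rfl⟩ := hgen u v w h
    have : x ^ (s * u₁ + t * u₂) * q ^ (s * v₁ + t * v₂) * y ^ (s * w₁ + t * w₂) =
        (x ^ u₁ * q ^ v₁ * y ^ w₁) ^ s * (x ^ u₂ * q ^ v₂ * y ^ w₂) ^ t := by
      simp only [zpow_add₀ hx, zpow_add₀ hq, zpow_add₀ hy, mul_zpow, ← zpow_mul]
      simp only [mul_comm s, mul_comm t]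
      ring
    rw [this, h₁, h₂, one_zpow, one_zpow, one_mul]
  obtain ⟨g₁, g₂, g₃, hg⟩ := hgcd
  have hpow : ∀ m : ℕ, (x ^ g₁ * q ^ g₂ * y ^ g₃) ^ m =
      x ^ (g₁ * m) * q ^ (g₂ * m) * y ^ (g₃ * m) := fun m => by
    simp only [← zpow_natCast, mul_zpow, ← zpow_mul]
  refine ⟨x ^ g₁ * q ^ g₂ * y ^ g₃, ?_, ?_, ?_⟩
  · have h := htriv (g₁ * a - 1) (g₂ * a) (g₃ * a) (by linear_combination (a : ℤ) * hg)
    rw [zpow_sub₀ hx, zpow_one] at h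
    rw [hpow]
    field_simp at h
    exact h.symm
  · have h := htriv (g₁ * d) (g₂ * d - 1) (g₃ * d) (by linear_combination (d : ℤ) * hg)
    rw [zpow_sub₀ hq, zpow_one] at h
    rw [hpow]
    field_simp at h
    exact h.symm
  · have h := htriv (g₁ * n) (g₂ * n) (g₃ * n - 1) (by linear_combination (n : ℤ) * hg)
    rw [zpow_sub₀ hy, zpow_one] at h
    rw [hpow]
    field_simp at h
    exact h.symm

theorem almost_arithmetic_stci_of_two_le (k : Type u) [Field k] {p a d : ℕ}
    (n : Fin (p + 3) → ℕ)
    (harith : ∀ i : Fin (p + 3), (i : ℕ) < p + 2 → n i = a + (i : ℕ) * d)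
    (hpos : ∀ i, 0 < n i) (hgcd : ∀ e : ℕ, (∀ i, e ∣ n i) → e = 1) :
    ∃ f : Fin (p + 2) → MvPolynomial (Fin (p + 3)) k,
      RingHom.ker (MvPolynomial.aeval (R := k) fun i => (X : k[X]) ^ n i).toRingHom =
        (Ideal.span (Set.range f)).radical := by
  have hval : ∀ l ≤ p + 1, (Fin.ofNat (p + 3) l : ℕ) = l := fun l hl => by
    simp only [Fin.val_ofNat]
    exact Nat.mod_eq_of_lt (by omega)
  have hn : ∀ l ≤ p + 1, n (Fin.ofNat (p + 3) l) = a + l * d := fun l hl => by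
    rw [harith _ (by rw [hval l hl]; omega), hval l hl]
  have ha : 0 < a := by
    have h := hpos (Fin.ofNat (p + 3) 0)
    rwa [hn 0 (Nat.zero_le _), zero_mul, add_zero] at h
  have hcases : ∀ i : Fin (p + 3), i = Fin.last (p + 2) ∨ ∃ l ≤ p + 1, i = Fin.ofNat (p + 3) l := by
    intro i
    rcases Nat.lt_or_ge i (p + 2) with h | h
    · exact Or.inr ⟨i, by omega, Fin.ext (hval i (by omega)).symm⟩
    · exact Or.inl (Fin.ext (by have := i.isLt; simp; omega))
  set m := n (Fin.last (p + 2)) with hm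
  have hcop : ∀ e : ℕ, e ∣ a → e ∣ d → e ∣ m → e = 1 := by
    intro e h1 h2 h3
    refine hgcd e fun i => ?_
    rcases hcases i with rfl | ⟨l, hl, rfl⟩
    · exact h3
    · rw [hn l hl]
      exact dvd_add h1 (h2.mul_left l)
  have hr : 0 < p + 1 := Nat.succ_pos p
  obtain ⟨c, D, j, b, e, D', hc, hb, hec, hj, hlt, hw₁, hw₂, hgen⟩ :=
    exists_adapted_lattice_basis hr ha (hpos _) hcop
  let v : ℕ → MvPolynomial (Fin (p + 3)) k := fun l => MvPolynomial.X (Fin.ofNat (p + 3) l)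
  let y : MvPolynomial (Fin (p + 3)) k := MvPolynomial.X (Fin.last (p + 2))
  let f : Fin (p + 2) → MvPolynomial (Fin (p + 3)) k := fun l =>
    if l = 0 then y ^ c - weightedMonomial v (p + 1) D j
    else if l = Fin.last (p + 1) then reducedPower v y (p + 1) c D j b e D'
    else normalCurveEquation v l
  have hf : ∀ (L : Type u) [Field L] [Algebra k L] (x : Fin (p + 3) → L),
      (∀ l, MvPolynomial.aeval x (f l) = 0) ↔
        x (Fin.last (p + 2)) ^ c =
          weightedMonomial (fun l => x (Fin.ofNat (p + 3) l)) (p + 1) D j ∧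
        reducedPower (fun l => x (Fin.ofNat (p + 3) l)) (x (Fin.last (p + 2)))
          (p + 1) c D j b e D' = 0 ∧
        ∀ i, 1 ≤ i → i < p + 1 → normalCurveEquation (fun l => x (Fin.ofNat (p + 3) l)) i = 0 := by
    intro L _ _ x
    have e₁ : MvPolynomial.aeval x (y ^ c - weightedMonomial v (p + 1) D j) =
        x (Fin.last (p + 2)) ^ c -
          weightedMonomial (fun l => x (Fin.ofNat (p + 3) l)) (p + 1) D j := by
      simp only [map_sub, map_pow, map_weightedMonomial, v, y, MvPolynomial.aeval_X]
    have e₂ : MvPolynomial.aeval x (reducedPower v y (p + 1) c D j b e D') =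
        reducedPower (fun l => x (Fin.ofNat (p + 3) l)) (x (Fin.last (p + 2)))
          (p + 1) c D j b e D' := by
      simp only [map_reducedPower, v, y, MvPolynomial.aeval_X]
    have e₃ : ∀ i, MvPolynomial.aeval x (normalCurveEquation v i) =
        normalCurveEquation (fun l => x (Fin.ofNat (p + 3) l)) i := fun i => by
      simp only [map_normalCurveEquation, v, MvPolynomial.aeval_X]
    have hlast : (Fin.last (p + 1)) ≠ 0 := Fin.last_pos.ne'
    constructor
    · intro h
      refine ⟨?_, ?_, fun i hi₁ hi₂ => ?_⟩
      · have := h 0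
        simp only [f, if_true, e₁] at this
        exact sub_eq_zero.mp this
      · have := h (Fin.last (p + 1))
        simpa only [f, if_neg hlast, if_true, e₂] using this
      · have := h ⟨i, by omega⟩
        simp only [f] at this
        rw [if_neg (by rw [Fin.ext_iff]; simp; omega), if_neg (by rw [Fin.ext_iff]; simp; omega),
          e₃] at this
        exact this
    · rintro ⟨h₁, h₂, h₃⟩ l
      simp only [f]
      split_ifs with hl hl'
      · rw [e₁, h₁, sub_self]
      · rw [e₂, h₂]
      · rw [e₃]
        rw [Fin.ext_iff] at hl hl'
        simp only [Fin.val_zero, Fin.val_last] at hl hl'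
        exact h₃ l (by omega) (by have := l.isLt; omega)
  refine ⟨f, ker_eq_radical_of_forall_zero n f (fun l => ?_) fun L _ _ x hx => ?_⟩
  · -- the equations vanish at the generic point of the curve
    let T : FractionRing k[X] := algebraMap k[X] _ X
    have hT : T ≠ 0 := by simp [T]
    apply IsFractionRing.injective k[X] (FractionRing k[X])
    rw [map_zero, ← MvPolynomial.aeval_algebraMap_apply]
    have hpoint : (algebraMap k[X] (FractionRing k[X]) ∘ fun i => X ^ n i) = fun i => T ^ n i :=
      funext fun i => map_pow _ _ _
    rw [hpoint]
    revert l
    rw [hf]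
    have hgeom : ∀ l ≤ p + 1, T ^ n (Fin.ofNat (p + 3) l) =
        T ^ n (Fin.ofNat (p + 3) 0) * (T ^ d) ^ l := fun l hl => by
      rw [hn l hl, hn 0 (Nat.zero_le _)]
      ring
    have hyc : (T ^ m) ^ c = (T ^ n (Fin.ofNat (p + 3) 0)) ^ D * (T ^ d) ^ j := by
      rw [hn 0 (Nat.zero_le _), ← pow_mul, ← pow_mul, ← pow_mul, ← pow_add]
      congr 1
      linarith
    refine ⟨?_, ?_, fun i hi₁ hi₂ => ?_⟩
    · rw [weightedMonomial_of_geometric hgeom hj]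
      exact hyc
    · rw [reducedPower_of_geometric hr hec hj hlt hgeom (pow_ne_zero _ hT) hyc]
      have hone : (T ^ n (Fin.ofNat (p + 3) 0)) ^ (-D') * (T ^ d) ^ b * (T ^ m) ^ e = 1 := by
        rw [hn 0 (Nat.zero_le _), ← pow_mul, ← pow_mul]
        simp only [← zpow_natCast, ← zpow_mul, ← zpow_add₀ hT]
        convert zpow_zero T using 2
        push_cast
        linarith
      rw [hone, sub_self, zero_pow (by positivity), mul_zero]
    · rw [normalCurveEquation_of_geometric fun l hl => hgeom l (by omega), ← hgeom _ (by omega),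
        sub_self, zero_pow (by omega), mul_zero]
  · obtain ⟨h₁, h₂, h₃⟩ := (hf L x).mp hx
    have hD : D ≠ 0 := by
      rintro rfl
      have hj0 : j = 0 := by simpa using hj
      have : 0 < c * m := Nat.mul_pos hc (hpos _)
      rw [hj0, zero_mul, zero_mul, add_zero] at hw₁
      exact this.ne hw₁
    by_cases h0 : x (Fin.ofNat (p + 3) 0) = 0
    · have hlow := eq_zero_of_normalCurveEquation h₃ h0
      have htop := eq_zero_of_reducedPower hr hb hec hj hlt hlow h₂
      have hy0 : x (Fin.last (p + 2)) = 0 := by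
        have hmono : weightedMonomial (fun l => x (Fin.ofNat (p + 3) l)) (p + 1) D j = 0 := by
          rcases hj.lt_or_eq with h | h
          · exact weightedMonomial_eq_zero hlow h
          · rw [h, weightedMonomial_mul_self, htop, zero_pow hD]
        rw [hmono] at h₁
        exact eq_zero_of_pow_eq_zero h₁
      refine ⟨0, fun i => ?_⟩
      rw [zero_pow (hpos i).ne']
      rcases hcases i with rfl | ⟨l, hl, rfl⟩
      · exact hy0
      · rcases hl.lt_or_eq with h | rfl
        · exact hlow l h
        · exact htop
    · have hgeom := geometric_of_normalCurveEquation h₃ h0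
      set q := x (Fin.ofNat (p + 3) 1) / x (Fin.ofNat (p + 3) 0)
      rw [weightedMonomial_of_geometric hgeom hj] at h₁
      rw [reducedPower_of_geometric hr hec hj hlt hgeom h0 h₁] at h₂
      have hone := (sub_eq_zero.mp (eq_zero_of_pow_eq_zero
        ((mul_eq_zero.mp h₂).resolve_left (zpow_ne_zero _ h0)))).symm
      have hq : q ≠ 0 := by
        intro hq
        rw [hq, zero_pow hb.ne', mul_zero, zero_mul] at hone
        exact zero_ne_one hone
      have hy : x (Fin.last (p + 2)) ≠ 0 := by
        intro hy
        rw [hy, zero_pow hc.ne'] at h₁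
        exact mul_ne_zero (pow_ne_zero _ h0) (pow_ne_zero _ hq) h₁.symm
      obtain ⟨t, ht₀, htq, hty⟩ := exists_parameter_of_lattice_generators h0 hq hy
        (exists_bezout_of_coprime hcop) (u₁ := D) (v₁ := j) (w₁ := -c)
        (u₂ := D') (v₂ := -b) (w₂ := -e) (by
          rw [zpow_neg, zpow_natCast, zpow_natCast, zpow_natCast, h₁]
          exact mul_inv_cancel₀ (mul_ne_zero (pow_ne_zero _ h0) (pow_ne_zero _ hq))) (by
          rw [← inv_inj, inv_one, ← hone]
          simp [zpow_neg, mul_comm]) hgen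
      refine ⟨t, fun i => ?_⟩
      rcases hcases i with rfl | ⟨l, hl, rfl⟩
      · exact hty
      · rw [hgeom l hl, hn l hl, ht₀, htq]
        ring

theorem plane_monomial_curve_stci (k : Type u) [Field k] (n : Fin 2 → ℕ)
    (hpos : ∀ i, 0 < n i) (hgcd : ∀ e : ℕ, (∀ i, e ∣ n i) → e = 1) :
    ∃ f : Fin 1 → MvPolynomial (Fin 2) k,
      RingHom.ker (MvPolynomial.aeval (R := k) fun i => (X : k[X]) ^ n i).toRingHom =
        (Ideal.span (Set.range f)).radical := by
  refine ⟨fun _ => MvPolynomial.X 0 ^ n 1 - MvPolynomial.X 1 ^ n 0,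
    ker_eq_radical_of_forall_zero n _ (fun _ => ?_) fun L _ _ x hx => ?_⟩
  · simp [← pow_mul, mul_comm]
  · have h : x 0 ^ n 1 = x 1 ^ n 0 := by
      simpa [sub_eq_zero] using hx 0
    by_cases h0 : x 0 = 0
    · have h1 : x 1 = 0 := by
        rw [h0, zero_pow (hpos 1).ne'] at h
        exact eq_zero_of_pow_eq_zero h.symm
      refine ⟨0, Fin.forall_fin_two.mpr ⟨?_, ?_⟩⟩
      · rw [h0, zero_pow (hpos 0).ne']
      · rw [h1, zero_pow (hpos 1).ne']
    · have h1 : x 1 ≠ 0 := by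
        intro h1
        rw [h1, zero_pow (hpos 0).ne'] at h
        exact pow_ne_zero _ h0 h
      have hone : Nat.gcd (n 0) (n 1) = 1 :=
        hgcd _ (Fin.forall_fin_two.mpr ⟨Nat.gcd_dvd_left _ _, Nat.gcd_dvd_right _ _⟩)
      have hbez := Nat.gcd_eq_gcd_ab (n 0) (n 1)
      rw [hone] at hbez
      set α := Nat.gcdA (n 0) (n 1)
      set β := Nat.gcdB (n 0) (n 1)
      have hz : x 0 ^ (n 1 : ℤ) = x 1 ^ (n 0 : ℤ) := by simpa using h
      refine ⟨x 0 ^ α * x 1 ^ β, Fin.forall_fin_two.mpr ⟨?_, ?_⟩⟩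
      · rw [← zpow_natCast, mul_zpow, ← zpow_mul, ← zpow_mul, mul_comm β, zpow_mul, zpow_mul, ← hz,
          ← zpow_mul, ← zpow_mul, ← zpow_add₀ h0, mul_comm α, ← hbez]
        simp
      · rw [← zpow_natCast, mul_zpow, ← zpow_mul, ← zpow_mul, mul_comm α, zpow_mul (x 0), hz,
          ← zpow_mul, ← zpow_add₀ h1, mul_comm β, ← hbez]
        simp

/-- **Patil.** Let `n₀, …, n_p` be a minimal almost arithmetic
sequence of positive integers with gcd `1`: `nᵢ = a + i·d` for `0 ≤ i ≤ p−1`, `n_p`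
is arbitrary, and `n₀, …, n_p` minimally generate `Γ(n₀, …, n_p)`.  Then the
defining ideal `𝔭(n₀, …, n_p) ⊆ k[x₀, …, x_p]` is a set-theoretic complete
intersection: there exist `p` polynomials `f₁, …, f_p` with
`𝔭(n₀, …, n_p) = √(f₁, …, f_p)`. -/
theorem patil_almost_arithmetic_stci (k : Type*) [Field k] (p : ℕ)
    (n : Fin (p + 1) → ℕ) (a d : ℕ)
    (harith : ∀ i : Fin (p + 1), (i : ℕ) < p → n i = a + (i : ℕ) * d)
    (hpos : ∀ i, 0 < n i) (hgcd : ∀ e : ℕ, (∀ i, e ∣ n i) → e = 1)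
    (hmin : ∀ i : Fin (p + 1),
      n i ∉ AddSubmonoid.closure {x : ℕ | ∃ j : Fin (p + 1), j ≠ i ∧ x = n j}) :
    ∃ f : Fin p → MvPolynomial (Fin (p + 1)) k,
      RingHom.ker (MvPolynomial.aeval (R := k) fun i => (X : k[X]) ^ n i).toRingHom =
        (Ideal.span (Set.range f)).radical := by
  match p, n, harith, hpos, hgcd with
  | 0, n, _, _, hgcd =>
    refine ⟨Fin.elim0, ker_eq_radical_of_forall_zero n _ (fun l => l.elim0) fun L _ _ x _ => ?_⟩
    have h1 : n 0 = 1 := hgcd _ fun i => by rw [Fin.fin_one_eq_zero i]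
    exact ⟨x 0, fun i => by rw [Fin.fin_one_eq_zero i, h1, pow_one]⟩
  | 1, n, _, hpos, hgcd => exact plane_monomial_curve_stci k n hpos hgcd
  | p + 2, n, harith, hpos, hgcd => exact almost_arithmetic_stci_of_two_le k n harith hpos hgcd
end

section
/- (Robbiano–Valla) The rational normal curve in ℙⁿ is a set-theoretic complete intersection: letting φ : k[x₀,...,x_n] → k[s,t] be the k-algebra homomorphism with φ(x_i) = s^{n−i} t^{i}, there exist n−1 homogeneous polynomials f₁,...,f_{n−1} ∈ k[x₀,...,x_n] such that ker φ equals the radical of the ideal (f₁,...,f_{n−1}). -/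
open MvPolynomial

universe u

/-- The form `∑ α, (-1)^α * C(i, α) * x_{i+1}^(i-α) * x_i^α * x_α` of degree `i + 1`. If
`x_α = u * r^α` for all `α ≤ i`, it equals `u * (x_{i+1} - u * r^(i+1))^i`. -/
def robbianoVallaForm {R : Type*} [CommRing R] (x : ℕ → R) (i : ℕ) : R :=
  ∑ α ∈ Finset.range (i + 1),
    (-1) ^ α * (i.choose α : R) * (x (i + 1) ^ (i - α) * x i ^ α * x α)

theorem map_robbianoVallaForm {R S : Type*} [CommRing R] [CommRing S] (g : R →+* S)
    (x : ℕ → R) (i : ℕ) :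
    g (robbianoVallaForm x i) = robbianoVallaForm (fun m => g (x m)) i := by
  simp [robbianoVallaForm]

theorem sum_neg_one_pow_mul_choose_mul {R : Type*} [CommRing R] (a b : R) (i : ℕ) :
    ∑ α ∈ Finset.range (i + 1), (-1) ^ α * (i.choose α : R) * (a ^ (i - α) * b ^ α) =
      (a - b) ^ i := by
  rw [sub_eq_neg_add, add_pow]
  refine Finset.sum_congr rfl fun α _ => ?_
  rw [neg_pow b]
  ring

theorem robbianoVallaForm_of_geometric {R : Type*} [CommRing R] (x : ℕ → R) (i : ℕ) (u r : R)
    (hx : ∀ α ≤ i, x α = u * r ^ α) :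
    robbianoVallaForm x i = u * (x (i + 1) - u * r ^ (i + 1)) ^ i := by
  rw [← sum_neg_one_pow_mul_choose_mul, Finset.mul_sum, robbianoVallaForm]
  refine Finset.sum_congr rfl fun α hα => ?_
  rw [hx i le_rfl, hx α (Nat.lt_succ_iff.mp (Finset.mem_range.mp hα))]
  ring

theorem robbianoVallaForm_of_curve {R : Type*} [CommRing R] (x : ℕ → R) (s t : R) (n i : ℕ)
    (hi : 1 ≤ i) (hin : i < n) (hx : ∀ m ≤ n, x m = s ^ (n - m) * t ^ m) :
    robbianoVallaForm x i = 0 := by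
  have key : ∀ α ∈ Finset.range (i + 1),
      (-1) ^ α * (i.choose α : R) * (x (i + 1) ^ (i - α) * x i ^ α * x α) =
        s ^ ((n - (i + 1)) * i + n) * t ^ ((i + 1) * i) *
          ((-1) ^ α * (i.choose α : R) * (1 ^ (i - α) * 1 ^ α)) := by
    intro α hα
    have hα : α ≤ i := Nat.lt_succ_iff.mp (Finset.mem_range.mp hα)
    obtain ⟨b, rfl⟩ := Nat.exists_eq_add_of_le hα
    obtain ⟨c, rfl⟩ := Nat.exists_eq_add_of_lt hin
    rw [hx (α + b + 1) hin, hx _ hin.le, hx α (by omega)]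
    rw [show α + b + c + 1 - (α + b + 1) = c by omega, show α + b - α = b by omega,
      show α + b + c + 1 - (α + b) = c + 1 by omega,
      show α + b + c + 1 - α = b + c + 1 by omega]
    ring
  rw [robbianoVallaForm, Finset.sum_congr rfl key, ← Finset.mul_sum,
    sum_neg_one_pow_mul_choose_mul, sub_self, zero_pow (by omega), mul_zero]

theorem robbianoVallaForm_isHomogeneous {k σ : Type*} [CommRing k] (v : ℕ → σ) (i : ℕ) :
    (robbianoVallaForm (fun m => (X (v m) : MvPolynomial σ k)) i).IsHomogeneous (i + 1) := by
  refine IsHomogeneous.sum _ _ _ fun α hα => ?_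
  have hα : α ≤ i := Nat.lt_succ_iff.mp (Finset.mem_range.mp hα)
  have hc : ((-1) ^ α * (i.choose α : MvPolynomial σ k)) = C ((-1) ^ α * (i.choose α : k)) := by
    simp
  rw [hc, show i + 1 = 0 + (1 * (i - α) + 1 * α + 1) by omega]
  exact (isHomogeneous_C _ _).mul
    ((((isHomogeneous_X k _).pow _).mul ((isHomogeneous_X k _).pow _)).mul (isHomogeneous_X k _))

/-- The common zeros of the forms over an algebraically closed field lie on the cone over the
rational normal curve. -/
theorem exists_curve_of_robbianoVallaForm_eq_zero {L : Type*} [Field L] [IsAlgClosed L]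
    (n : ℕ) (hn : 1 ≤ n) (y : ℕ → L)
    (hy : ∀ i, 1 ≤ i → i < n → robbianoVallaForm y i = 0) :
    ∃ s t : L, ∀ m ≤ n, y m = s ^ (n - m) * t ^ m := by
  by_cases h0 : y 0 = 0
  · have hzero : ∀ m < n, y m = 0 := by
      intro m
      induction m using Nat.strong_induction_on with
      | _ m ih =>
        intro hm
        rcases Nat.eq_zero_or_pos m with rfl | hpos
        · exact h0
        have h := hy m hpos hm
        rw [robbianoVallaForm, Finset.sum_range_succ, Finset.sum_eq_zero] at h
        · simpa [hpos.ne', or_iff_right_of_imp And.left] using h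
        · intro α hα
          have hα := Finset.mem_range.mp hα
          rw [ih α hα (hα.trans hm), mul_zero, mul_zero]
    obtain ⟨t, ht⟩ := IsAlgClosed.exists_pow_nat_eq (y n) hn
    refine ⟨0, t, fun m hm => ?_⟩
    rcases hm.lt_or_eq with hm | rfl
    · rw [hzero m hm, zero_pow (by omega), zero_mul]
    · simp [ht]
  · have hgeom : ∀ m ≤ n, y m = y 0 * (y 1 / y 0) ^ m := by
      intro m
      induction m using Nat.strong_induction_on with
      | _ m ih =>
        intro hm
        rcases m with _ | _ | i
        · simp
        · simp [mul_div_cancel₀ _ h0]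
        · have h := hy (i + 1) (by omega) (by omega)
          rw [robbianoVallaForm_of_geometric y (i + 1) (y 0) (y 1 / y 0)
            fun α hα => ih α (by omega) (by omega)] at h
          exact sub_eq_zero.mp (eq_zero_of_pow_eq_zero ((mul_eq_zero.mp h).resolve_left h0))
    obtain ⟨s, hs⟩ := IsAlgClosed.exists_pow_nat_eq (y 0) hn
    refine ⟨s, s * (y 1 / y 0), fun m hm => ?_⟩
    rw [hgeom m hm, mul_pow, ← mul_assoc, ← pow_add, Nat.sub_add_cancel hm, hs]

/-- Every prime ideal of a `k`-algebra is the kernel of a map to an algebraically closed field. -/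
theorem exists_algHom_algClosed_eq_zero_iff_mem (k : Type*) {A : Type u} [Field k] [CommRing A]
    [Algebra k A] (P : Ideal A) [P.IsPrime] :
    ∃ (L : Type u) (_ : Field L) (_ : IsAlgClosed L) (_ : Algebra k L) (ψ : A →ₐ[k] L),
      ∀ a, ψ a = 0 ↔ a ∈ P := by
  let K := FractionRing (A ⧸ P)
  let ψ : A →+* AlgebraicClosure K :=
    (algebraMap K _).comp ((algebraMap (A ⧸ P) K).comp (Ideal.Quotient.mk P))
  let _ : Algebra k (AlgebraicClosure K) := (ψ.comp (algebraMap k A)).toAlgebra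
  refine ⟨AlgebraicClosure K, inferInstance, inferInstance, inferInstance,
    { ψ with commutes' := fun _ => rfl }, fun a => ?_⟩
  change algebraMap K (AlgebraicClosure K) (algebraMap (A ⧸ P) K (Ideal.Quotient.mk P a)) = 0 ↔ _
  rw [map_eq_zero, IsFractionRing.to_map_eq_zero_iff, Ideal.Quotient.eq_zero_iff_mem]


/-- **Robbiano–Valla.** The rational normal curve of degree `n ≥ 2`
in `ℙⁿ` is a set-theoretic complete intersection: letting
`φ : k[x₀, …, x_n] → k[s,t]` be the `k`-algebra map with `φ(xᵢ) = s^{n−i}tⁱ`, there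
exist `n−1` homogeneous polynomials `f₁, …, f_{n−1}` with `ker φ = √(f₁, …, f_{n−1})`.
(Here `k[s,t]` is realised as `MvPolynomial (Fin 2) k`, with `s, t` the variables
indexed by `0, 1`.) -/
theorem rational_normal_curve_stci (k : Type*) [Field k] (n : ℕ) (hn : 2 ≤ n) :
    ∃ f : Fin (n - 1) → MvPolynomial (Fin (n + 1)) k,
      (∀ j, ∃ dj : ℕ, MvPolynomial.IsHomogeneous (f j) dj) ∧
      RingHom.ker (MvPolynomial.aeval (R := k)
          (fun i : Fin (n + 1) =>
            (MvPolynomial.X 0 : MvPolynomial (Fin 2) k) ^ (n - (i : ℕ)) *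
              (MvPolynomial.X 1 : MvPolynomial (Fin 2) k) ^ (i : ℕ))).toRingHom =
        (Ideal.span (Set.range f)).radical := by
  let v : ℕ → Fin (n + 1) := Fin.ofNat (n + 1)
  have hv : ∀ m ≤ n, ((v m : Fin (n + 1)) : ℕ) = m := fun m hm =>
    Nat.mod_eq_of_lt (Nat.lt_succ_iff.mpr hm)
  refine ⟨fun j => robbianoVallaForm (fun m => X (v m)) (j + 1),
    fun j => ⟨_, robbianoVallaForm_isHomogeneous v _⟩, le_antisymm ?_ ?_⟩
  · intro g hg
    rw [Ideal.radical_eq_sInf, Submodule.mem_sInf]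
    rintro P ⟨hP, hprime⟩
    obtain ⟨L, _, _, _, ψ, hψ⟩ := exists_algHom_algClosed_eq_zero_iff_mem k P
    obtain ⟨s, t, hst⟩ := exists_curve_of_robbianoVallaForm_eq_zero n (by omega)
      (fun m => ψ (X (v m))) fun i hi hin => by
        have hmem := hP (Ideal.subset_span ⟨⟨i - 1, by omega⟩, rfl⟩)
        rw [← hψ] at hmem
        simp only [Nat.sub_add_cancel hi] at hmem
        exact (map_robbianoVallaForm ψ.toRingHom (fun m => X (v m)) i).symm.trans hmem
    have hfac : ψ = (aeval ![s, t]).comp (aeval fun i : Fin (n + 1) =>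
        (X 0 : MvPolynomial (Fin 2) k) ^ (n - (i : ℕ)) * X 1 ^ (i : ℕ)) := by
      ext i
      have hi : v i = i := Fin.ext (hv i (Nat.lt_succ_iff.mp i.2))
      have h := hst i (Nat.lt_succ_iff.mp i.2)
      simp only [hi] at h
      simp [h]
    rw [← hψ, hfac, AlgHom.comp_apply]
    exact (congrArg _ ((RingHom.mem_ker).mp hg)).trans (map_zero _)
  · rw [(RingHom.ker_isPrime _).isRadical.radical_le_iff, Ideal.span_le]
    rintro _ ⟨j, rfl⟩
    rw [SetLike.mem_coe, RingHom.mem_ker, map_robbianoVallaForm]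
    refine robbianoVallaForm_of_curve _ (X 0) (X 1) n _ (by omega) (by omega) fun m hm => ?_
    simp [hv m hm]
end

section
/- (Bresinsky) Let n₀ < n₁ < n₂ < n₃ be positive integers with gcd 1 minimally generating a symmetric numerical semigroup Γ(n₀,n₁,n₂,n₃). Then the defining ideal 𝔭(n₀,n₁,n₂,n₃) ⊆ k[x₀,x₁,x₂,x₃] is a set-theoretic complete intersection: there exist polynomials f₁, f₂, f₃ such that 𝔭(n₀,n₁,n₂,n₃) equals the radical of the ideal (f₁,f₂,f₃). -/
open Polynomial

/-- The prime of a monomial curve is cut out, over every extension field, by three of its elements: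
each common zero is either the origin or a point of the torus on which all lattice relations
of `n` hold. -/
def IsCutOut.{u} (k : Type u) [Field k] (n : Fin 4 → ℕ) : Prop :=
  ∃ f : Fin 3 → MvPolynomial (Fin 4) k,
    (∀ s, MvPolynomial.aeval (fun i => (X : k[X]) ^ n i) (f s) = 0) ∧
    ∀ (K : Type u) [Field K] [Algebra k K] (a : Fin 4 → K),
      (∀ s, MvPolynomial.aeval a (f s) = 0) →
        (∀ i, a i = 0) ∨ ((∀ i, a i ≠ 0) ∧
          ∀ v : Fin 4 → ℤ, ∑ i, v i * (n i : ℤ) = 0 → ∏ i, a i ^ v i = 1)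

theorem exists_bezout {n : Fin 4 → ℕ} (hgcd : ∀ d : ℕ, (∀ i, d ∣ n i) → d = 1) :
    ∃ v : Fin 4 → ℤ, ∑ i, v i * (n i : ℤ) = 1 := by
  have h1 : Finset.univ.gcd (fun i => (n i : ℤ)) = 1 := by
    have hd := hgcd (Finset.univ.gcd (fun i => (n i : ℤ))).natAbs fun i => by
      have := Finset.gcd_dvd (f := fun i => (n i : ℤ)) (Finset.mem_univ i)
      simpa using Int.natAbs_dvd_natAbs.mpr this
    rw [← Finset.normalize_gcd, ← Int.abs_eq_normalize, Int.abs_eq_natAbs, hd]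
    rfl
  obtain ⟨v, hv⟩ := Finset.gcd_eq_sum_mul Finset.univ (fun i => (n i : ℤ))
  exact ⟨v, by rw [← h1, hv]; exact Finset.sum_congr rfl fun i _ => mul_comm _ _⟩

theorem eval_eq_zero_of_lattice {k K : Type*} [Field k] [Field K] [Algebra k K] {n : Fin 4 → ℕ}
    (hgcd : ∀ d : ℕ, (∀ i, d ∣ n i) → d = 1) {a : Fin 4 → K} (ha : ∀ i, a i ≠ 0)
    (hlat : ∀ v : Fin 4 → ℤ, ∑ i, v i * (n i : ℤ) = 0 → ∏ i, a i ^ v i = 1)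
    {f : MvPolynomial (Fin 4) k}
    (hf : MvPolynomial.aeval (fun i => (X : k[X]) ^ n i) f = 0) :
    MvPolynomial.aeval a f = 0 := by
  obtain ⟨v, hv⟩ := exists_bezout hgcd
  set τ : K := ∏ i, a i ^ v i with hτ
  have hpow : ∀ j, a j = τ ^ n j := by
    intro j
    have h := hlat (fun i => (if i = j then 1 else 0) - n j * v i) (by
      simp only [sub_mul, Finset.sum_sub_distrib, mul_assoc, ← Finset.mul_sum, hv]
      simp)
    simp only [zpow_sub₀ (ha _), Finset.prod_div_distrib] at h
    have h2 : ∏ i, a i ^ ((n j : ℤ) * v i) = τ ^ n j := by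
      rw [hτ, ← Finset.prod_pow]
      exact Finset.prod_congr rfl fun i _ => by rw [mul_comm, zpow_mul, zpow_natCast]
    have h3 : ∏ i, a i ^ (if i = j then (1 : ℤ) else 0) = a j := by
      rw [Finset.prod_eq_single j] <;> simp +contextual
    rw [h2, h3] at h
    exact eq_of_div_eq_one h
  have hcomp : MvPolynomial.aeval a f =
      Polynomial.aeval τ (MvPolynomial.aeval (fun i => (X : k[X]) ^ n i) f) := by
    rw [← AlgHom.comp_apply, MvPolynomial.comp_aeval]
    congr 2
    funext i
    simpa using hpow i
  rw [hcomp, hf, map_zero]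

theorem IsCutOut.exists_radical_span {k : Type*} [Field k] {n : Fin 4 → ℕ} (hpos : ∀ i, 0 < n i)
    (hgcd : ∀ d : ℕ, (∀ i, d ∣ n i) → d = 1) (h : IsCutOut k n) :
    ∃ f₁ f₂ f₃ : MvPolynomial (Fin 4) k,
      RingHom.ker (MvPolynomial.aeval (R := k) fun i => (X : k[X]) ^ n i).toRingHom =
        (Ideal.span {f₁, f₂, f₃}).radical := by
  obtain ⟨f, hf, hzero⟩ := h
  refine ⟨f 0, f 1, f 2, le_antisymm ?_ ?_⟩
  · intro g hg
    have hg : MvPolynomial.aeval (fun i => (X : k[X]) ^ n i) g = 0 := hg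
    rw [Ideal.radical_eq_sInf, Submodule.mem_sInf]
    rintro Q ⟨hQ, hprime⟩
    let K := FractionRing (MvPolynomial (Fin 4) k ⧸ Q)
    let φ : MvPolynomial (Fin 4) k →ₐ[k] K :=
      (IsScalarTower.toAlgHom k (MvPolynomial (Fin 4) k ⧸ Q) K).comp (Ideal.Quotient.mkₐ k Q)
    have hφ : ∀ p, φ p = 0 ↔ p ∈ Q := fun p => by
      simp only [φ, AlgHom.comp_apply, IsScalarTower.coe_toAlgHom', Ideal.Quotient.mkₐ_eq_mk]
      rw [FaithfulSMul.algebraMap_eq_zero_iff, Ideal.Quotient.eq_zero_iff_mem]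
    have hev : ∀ p, MvPolynomial.aeval (fun i => φ (MvPolynomial.X i)) p = φ p := fun p =>
      (DFunLike.congr_fun (MvPolynomial.aeval_unique φ) p).symm
    rw [← hφ, ← hev]
    rcases hzero K (fun i => φ (MvPolynomial.X i)) (fun s => by
      rw [hev, hφ]
      apply hQ
      apply Ideal.subset_span
      fin_cases s <;> simp) with h0 | ⟨hne, hlat⟩
    · have hc : MvPolynomial.constantCoeff g = 0 := by
        have := congrArg (Polynomial.aeval (0 : k)) hg
        rw [← AlgHom.comp_apply, MvPolynomial.comp_aeval] at this
        simpa [(hpos _).ne', MvPolynomial.aeval_zero'] using this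
      have : (fun i => φ (MvPolynomial.X i)) = fun _ : Fin 4 => (0 : K) := funext h0
      rw [this, MvPolynomial.aeval_zero', hc, map_zero]
    · exact eval_eq_zero_of_lattice hgcd hne hlat hg
  · have hp : (RingHom.ker (MvPolynomial.aeval (R := k)
        fun i => (X : k[X]) ^ n i).toRingHom).IsPrime := RingHom.ker_isPrime _
    rw [hp.radical_le_iff, Ideal.span_le]
    rintro g (rfl | rfl | rfl)
    exacts [hf 0, hf 1, hf 2]

theorem IsCutOut.of_perm {k : Type*} [Field k] {n : Fin 4 → ℕ} (σ : Equiv.Perm (Fin 4))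
    (h : IsCutOut k (n ∘ σ)) : IsCutOut k n := by
  obtain ⟨f, hf, hzero⟩ := h
  refine ⟨fun s => MvPolynomial.rename σ (f s), fun s => ?_, fun K _ _ a ha => ?_⟩
  · rw [MvPolynomial.aeval_rename]
    exact hf s
  · simp only [MvPolynomial.aeval_rename] at ha
    rcases hzero K (a ∘ σ) ha with h0 | ⟨hne, hlat⟩
    · exact .inl fun i => by simpa using h0 (σ.symm i)
    · refine .inr ⟨fun i => by simpa using hne (σ.symm i), fun v hv => ?_⟩
      have := hlat (v ∘ σ) (by
        rw [← hv]
        exact Equiv.sum_comp σ fun i => v i * (n i : ℤ))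
      rw [← this]
      exact (Equiv.prod_comp σ fun i => a i ^ v i).symm

theorem forall_fin_four {P : Fin 4 → Prop} : (∀ i, P i) ↔ P 0 ∧ P 1 ∧ P 2 ∧ P 3 := by
  simp [Fin.forall_fin_succ]

section LatticeRelations

variable {K : Type*} [Field K] {a : Fin 4 → K}

theorem prod_zpow_add (ha : ∀ i, a i ≠ 0) (u v : Fin 4 → ℤ) :
    ∏ i, a i ^ (u + v) i = (∏ i, a i ^ u i) * ∏ i, a i ^ v i := by
  simp only [Pi.add_apply, zpow_add₀ (ha _), Finset.prod_mul_distrib]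

theorem prod_zpow_smul (c : ℤ) (u : Fin 4 → ℤ) :
    ∏ i, a i ^ (c • u) i = (∏ i, a i ^ u i) ^ c := by
  simp only [Pi.smul_apply, smul_eq_mul, mul_comm c, zpow_mul, Finset.prod_zpow]

theorem prod_zpow_eq_one_of_combination (ha : ∀ i, a i ≠ 0) {r : Fin 3 → Fin 4 → ℤ}
    (hr : ∀ s, ∏ i, a i ^ r s i = 1) {v : Fin 4 → ℤ} {p : Fin 3 → ℤ}
    (hv : v = ∑ s, p s • r s) : ∏ i, a i ^ v i = 1 := by
  rw [hv, Fin.sum_univ_three, prod_zpow_add ha, prod_zpow_add ha]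
  simp only [prod_zpow_smul, hr, one_zpow, mul_one]

theorem prod_zpow_sub_natCast (ha : ∀ i, a i ≠ 0) (e e' : Fin 4 → ℕ) :
    ∏ i, a i ^ ((e i : ℤ) - e' i) = (∏ i, a i ^ e i) / ∏ i, a i ^ e' i := by
  simp only [zpow_sub₀ (ha _), zpow_natCast, Finset.prod_div_distrib]

end LatticeRelations

theorem IsCutOut.of_binomials.{u} {k : Type u} [Field k] {n : Fin 4 → ℕ} (e e' : Fin 3 → Fin 4 → ℕ)
    (hdeg : ∀ s, ∑ i, e s i * n i = ∑ i, e' s i * n i)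
    (hlat : ∀ v : Fin 4 → ℤ, ∑ i, v i * (n i : ℤ) = 0 →
      ∃ p : Fin 3 → ℤ, v = ∑ s, p s • fun i => (e s i : ℤ) - e' s i)
    (hzero : ∀ (K : Type u) [Field K] (a : Fin 4 → K),
      (∀ s, ∏ i, a i ^ e s i = ∏ i, a i ^ e' s i) → (∃ i, a i = 0) → ∀ i, a i = 0) :
    IsCutOut k n := by
  refine ⟨fun s => (∏ i, MvPolynomial.X i ^ e s i) - ∏ i, MvPolynomial.X i ^ e' s i,
    fun s => ?_, fun K _ _ a ha => ?_⟩
  · simp only [map_sub, map_prod, map_pow, MvPolynomial.aeval_X, ← pow_mul, sub_eq_zero,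
      Finset.prod_pow_eq_pow_sum, mul_comm (n _), hdeg]
  · simp only [map_sub, map_prod, map_pow, MvPolynomial.aeval_X, sub_eq_zero] at ha
    by_cases h : ∃ i, a i = 0
    · exact .inl (hzero K a ha h)
    · push Not at h
      refine .inr ⟨h, fun v hv => ?_⟩
      obtain ⟨p, hp⟩ := hlat v hv
      refine prod_zpow_eq_one_of_combination h (fun s => ?_) hp
      rw [prod_zpow_sub_natCast h, ha,
        div_self (Finset.prod_ne_zero_iff.2 fun i _ => pow_ne_zero _ (h i))]

theorem IsCutOut.of_triangular {k : Type*} [Field k] {n : Fin 4 → ℕ} (hpos : ∀ i, 0 < n i)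
    {F : ℤ} (hF : ∀ u : Fin 4 → ℤ, (∀ i, 0 ≤ u i) → ∑ i, u i * (n i : ℤ) ≠ F)
    {p q r A B C D E G : ℕ} (hp : 0 < p) (hq : 0 < q) (hr : 0 < r)
    (h₁ : p * n 1 = A * n 0) (h₂ : q * n 2 = B * n 0 + C * n 1)
    (h₃ : r * n 3 = D * n 0 + E * n 1 + G * n 2)
    (hFeq : -(n 0 : ℤ) + (p - 1) * n 1 + (q - 1) * n 2 + (r - 1) * n 3 = F) :
    IsCutOut k n := by
  have n0 := hpos 0
  have n1 := hpos 1
  have n2 := hpos 2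
  have n3 := hpos 3
  refine .of_binomials ![![0, p, 0, 0], ![0, 0, q, 0], ![0, 0, 0, r]]
    ![![A, 0, 0, 0], ![B, C, 0, 0], ![D, E, G, 0]] ?_ ?_ ?_
  · intro s
    fin_cases s <;> simp [Fin.sum_univ_four, h₁, h₂, h₃]
  · intro v hv
    have hw := Int.mul_ediv_add_emod (v 3) r
    have hw0 := Int.emod_nonneg (v 3) (b := r) (by omega)
    have hw1 := Int.emod_lt_of_pos (v 3) (b := r) (by omega)
    set γ := v 3 / r
    set w := v 3 % r
    have hz := Int.mul_ediv_add_emod (v 2 + γ * G) q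
    have hz0 := Int.emod_nonneg (v 2 + γ * G) (b := q) (by omega)
    have hz1 := Int.emod_lt_of_pos (v 2 + γ * G) (b := q) (by omega)
    set β := (v 2 + γ * G) / q
    set z := (v 2 + γ * G) % q
    have hy := Int.mul_ediv_add_emod (v 1 + γ * E + β * C) p
    have hy0 := Int.emod_nonneg (v 1 + γ * E + β * C) (b := p) (by omega)
    have hy1 := Int.emod_lt_of_pos (v 1 + γ * E + β * C) (b := p) (by omega)
    set α := (v 1 + γ * E + β * C) / p
    set y := (v 1 + γ * E + β * C) % p
    set x := v 0 + γ * D + β * B + α * A with hx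
    zify at h₁ h₂ h₃
    have hdeg : x * n 0 + y * n 1 + z * n 2 + w * n 3 = 0 := by
      rw [Fin.sum_univ_four] at hv
      linear_combination hv + γ * h₃ * (-1) + β * h₂ * (-1) + α * h₁ * (-1) + n 3 * hw
        + n 2 * hz + n 1 * hy + (n 0 : ℤ) * hx
    zify at n0 n1 n2 n3
    have hx0 : 0 ≤ x := by
      by_contra hneg
      refine hF ![-1 - x, p - 1 - y, q - 1 - z, r - 1 - w] ?_ ?_
      · intro i
        fin_cases i <;> simp <;> omega
      · simp only [Fin.sum_univ_four, Matrix.cons_val]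
        linear_combination hFeq - hdeg
    have hxz : x = 0 ∧ y = 0 ∧ z = 0 ∧ w = 0 := by
      have := mul_nonneg hx0 n0.le
      have := mul_nonneg hy0 n1.le
      have := mul_nonneg hz0 n2.le
      have := mul_nonneg hw0 n3.le
      refine ⟨?_, ?_, ?_, ?_⟩
      · exact (mul_eq_zero.1 (by linarith : x * n 0 = 0)).resolve_right n0.ne'
      · exact (mul_eq_zero.1 (by linarith : y * n 1 = 0)).resolve_right n1.ne'
      · exact (mul_eq_zero.1 (by linarith : z * n 2 = 0)).resolve_right n2.ne'
      · exact (mul_eq_zero.1 (by linarith : w * n 3 = 0)).resolve_right n3.ne'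
    obtain ⟨x0, y0, z0, w0⟩ := hxz
    refine ⟨![α, β, γ], ?_⟩
    funext i
    fin_cases i <;> simp [Fin.sum_univ_three] <;> linarith
  · intro K _ a ha h0
    have e₁ := ha 0
    have e₂ := ha 1
    have e₃ := ha 2
    simp [Fin.prod_univ_four] at e₁ e₂ e₃
    have hA : A ≠ 0 := by rintro rfl; simp at h₁; omega
    have hBC : B ≠ 0 ∨ C ≠ 0 := by
      by_contra! h
      simp [h] at h₂; omega
    have hDEG : D ≠ 0 ∨ E ≠ 0 ∨ G ≠ 0 := by
      by_contra! h
      simp [h] at h₃; omega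
    have k₁ : a 1 = 0 ↔ a 0 = 0 := by
      rw [← pow_eq_zero_iff hp.ne', e₁, pow_eq_zero_iff hA]
    have k₂ : a 2 = 0 ↔ a 0 = 0 := by
      rw [← pow_eq_zero_iff hq.ne', e₂, mul_eq_zero, pow_eq_zero_iff', pow_eq_zero_iff', k₁]
      tauto
    have k₃ : a 3 = 0 ↔ a 0 = 0 := by
      rw [← pow_eq_zero_iff hr.ne', e₃, mul_eq_zero, mul_eq_zero, pow_eq_zero_iff',
        pow_eq_zero_iff', pow_eq_zero_iff', k₁, k₂]
      tauto
    have hall : ∀ i, a i = 0 ↔ a 0 = 0 := forall_fin_four.2 ⟨Iff.rfl, k₁, k₂, k₃⟩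
    obtain ⟨i, hi⟩ := h0
    exact fun l => (hall l).2 ((hall i).1 hi)

theorem IsCutOut.of_gluing {k : Type*} [Field k] {n : Fin 4 → ℕ} (hpos : ∀ i, 0 < n i)
    {p q r s i j c d : ℕ} (hp : 0 < p) (hr : 0 < r)
    (h₁ : p * n 0 = q * n 1) (h₂ : r * n 2 = s * n 3)
    (h₃ : i * n 0 + j * n 1 = c * n 2 + d * n 3) (hij : 0 < i ∨ 0 < j)
    (hlat : ∀ v : Fin 4 → ℤ, ∑ i, v i * (n i : ℤ) = 0 → ∃ α β γ : ℤ,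
      v 0 = α * p + γ * i ∧ v 1 = -α * q + γ * j ∧ v 2 = β * r - γ * c ∧
        v 3 = -β * s - γ * d) :
    IsCutOut k n := by
  have n0 := hpos 0
  have n1 := hpos 1
  have n2 := hpos 2
  have n3 := hpos 3
  refine .of_binomials ![![p, 0, 0, 0], ![0, 0, r, 0], ![i, j, 0, 0]]
    ![![0, q, 0, 0], ![0, 0, 0, s], ![0, 0, c, d]] ?_ ?_ ?_
  · intro t
    fin_cases t <;> simp [Fin.sum_univ_four, h₁, h₂, h₃]
  · intro v hv
    obtain ⟨α, β, γ, e0, e1, e2, e3⟩ := hlat v hv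
    refine ⟨![α, β, γ], ?_⟩
    funext t
    fin_cases t <;> simp [Fin.sum_univ_three, *] <;> ring
  · intro K _ a ha h0
    have e₁ := ha 0
    have e₂ := ha 1
    have e₃ := ha 2
    simp [Fin.prod_univ_four] at e₁ e₂ e₃
    have hq : q ≠ 0 := by rintro rfl; simp at h₁; omega
    have hs : s ≠ 0 := by rintro rfl; simp at h₂; omega
    have hcd : c ≠ 0 ∨ d ≠ 0 := by
      by_contra! h
      simp [h] at h₃; omega
    have k₁ : a 0 = 0 ↔ a 1 = 0 := by
      rw [← pow_eq_zero_iff hp.ne', e₁, pow_eq_zero_iff hq]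
    have k₂ : a 2 = 0 ↔ a 3 = 0 := by
      rw [← pow_eq_zero_iff hr.ne', e₂, pow_eq_zero_iff hs]
    have k₃ : a 1 = 0 ↔ a 3 = 0 := by
      have : a 0 ^ i * a 1 ^ j = 0 ↔ a 2 ^ c * a 3 ^ d = 0 := by rw [e₃]
      simp only [mul_eq_zero, pow_eq_zero_iff', k₁, k₂] at this
      rw [Nat.pos_iff_ne_zero, Nat.pos_iff_ne_zero] at hij
      tauto
    have hall : ∀ i, a i = 0 ↔ a 3 = 0 :=
      forall_fin_four.2 ⟨k₁.trans k₃, k₃, k₂, Iff.rfl⟩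
    obtain ⟨i, hi⟩ := h0
    exact fun l => (hall l).2 ((hall i).1 hi)

section GorensteinLattice

variable {n₀ n₁ n₂ n₃ F a a' b b' c c' d d' : ℤ} {R : ℤ → ℤ → ℤ → ℤ → Prop}

/-- In a class of monomials some member of which is divisible by the first variable,
the rewriting rules `R` lead from any monomial to one divisible by the first variable. -/
theorem exists_pos_of_rewriting
    (ha : 0 < a) (ha' : 0 < a') (hb : 0 < b) (hb' : 0 < b') (hc' : 0 < c')
    (hd : 0 < d) (hd' : 0 < d')
    (hF : ∀ x y z w : ℤ, 0 ≤ x → 0 ≤ y → 0 ≤ z → 0 ≤ w →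
      x * n₀ + y * n₁ + z * n₂ + w * n₃ ≠ F)
    (hFeq : -n₀ + (b + b' - 1) * n₁ + (c + c' - 1) * n₂ + (d - 1) * n₃ = F)
    (hdeg : ∀ {x y z w}, R x y z w → x * n₀ + y * n₁ + z * n₂ + w * n₃ = 0)
    (hadd : ∀ {x y z w x' y' z' w'}, R x y z w → R x' y' z' w' →
      R (x + x') (y + y') (z + z') (w + w'))
    (h0 : R 0 0 0 0)
    (h₁ : R (a + a') 0 (-c) (-d)) (h₂n : R a (-b - b') 0 d')
    (h₃n : R a' b (-c - c') 0) (h₃ : R (-a') (-b) (c + c') 0)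
    (h₄n : R 0 b' c' (-d - d'))
    (m : ℕ) : ∀ {i j k l x y z w : ℤ}, 0 ≤ i → 0 ≤ j → 0 ≤ k → 0 ≤ l → 0 < x → 0 ≤ y → 0 ≤ z →
      0 ≤ w → x * n₀ + y * n₁ + z * n₂ + w * n₃ = i * n₀ + j * n₁ + k * n₂ + l * n₃ → l < m →
      ∃ x' y' z' w' : ℤ, 0 < x' ∧ 0 ≤ y' ∧ 0 ≤ z' ∧ 0 ≤ w' ∧
        R (x' - i) (y' - j) (z' - k) (w' - l) := by
  induction m with
  | zero => intros; omega
  | succ m ih =>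
    intro i j k l x y z w hi hj hk hl hx hy hz hw he hlm
    rcases hi.lt_or_eq with hi | rfl
    · exact ⟨i, j, k, l, hi, hj, hk, hl, by simpa using h0⟩
    by_cases hj1 : b + b' ≤ j
    · exact ⟨a, j - b - b', k, l + d', ha, by omega, hk, by omega, by
        convert h₂n using 1 <;> ring⟩
    by_cases hk1 : c + c' ≤ k
    · exact ⟨a', j + b, k - c - c', l, ha', by omega, by omega, hl, by
        convert h₃n using 1 <;> ring⟩
    by_cases hl1 : d ≤ l
    · by_cases hj2 : b ≤ j
      · exact ⟨a, j - b, k + c', l - d, ha, by omega, by omega, by omega, by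
          convert hadd h₁ h₃ using 1 <;> ring⟩
      by_cases hk2 : c ≤ k
      · exact ⟨a + a', j, k - c, l - d, by omega, by omega, by omega, by omega, by
          convert h₁ using 1 <;> ring⟩
      by_cases hl2 : 2 * d + d' ≤ l
      · have h4 := hdeg h₄n
        obtain ⟨x', y', z', w', hx', hy', hz', hw', h⟩ :=
          ih (i := 0) (j := j + b') (k := k + c') (l := l - d - d') le_rfl (by omega) (by omega)
            (by omega) hx hy hz hw (by linear_combination he - h4) (by push_cast at hlm; omega)
        exact ⟨x', y', z', w', hx', hy', hz', hw', by
          convert hadd h h₄n using 1 <;> ring⟩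
      · have h4 := hdeg h₄n
        refine absurd ?_ (hF (x - 1) (b - 1 - j + y) (c - 1 - k + z) (2 * d + d' - 1 - l + w)
          (by omega) (by omega) (by omega) (by omega))
        linear_combination hFeq + he - h4
    · refine absurd ?_ (hF (x - 1) (b + b' - 1 - j + y) (c + c' - 1 - k + z) (d - 1 - l + w)
        (by omega) (by omega) (by omega) (by omega))
      linear_combination hFeq + he

theorem relation_of_degree_eq_zero
    (hn₀ : 0 < n₀) (hn₁ : 0 < n₁) (hn₂ : 0 < n₂) (hn₃ : 0 < n₃)
    (ha : 0 < a) (ha' : 0 < a') (hb : 0 < b) (hb' : 0 < b') (hc : 0 < c) (hc' : 0 < c')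
    (hd : 0 < d) (hd' : 0 < d')
    (hF : ∀ x y z w : ℤ, 0 ≤ x → 0 ≤ y → 0 ≤ z → 0 ≤ w →
      x * n₀ + y * n₁ + z * n₂ + w * n₃ ≠ F)
    (hFeq : -n₀ + (b + b' - 1) * n₁ + (c + c' - 1) * n₂ + (d - 1) * n₃ = F)
    (hdeg : ∀ {x y z w}, R x y z w → x * n₀ + y * n₁ + z * n₂ + w * n₃ = 0)
    (hadd : ∀ {x y z w x' y' z' w'}, R x y z w → R x' y' z' w' →
      R (x + x') (y + y') (z + z') (w + w'))
    (hneg : ∀ {x y z w}, R x y z w → R (-x) (-y) (-z) (-w))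
    (h₁ : R (a + a') 0 (-c) (-d)) (h₃ : R (-a') (-b) (c + c') 0)
    (h₄ : R 0 (-b') (-c') (d + d'))
    {x y z w : ℤ} (hv : x * n₀ + y * n₁ + z * n₂ + w * n₃ = 0) : R x y z w := by
  have h0 : R 0 0 0 0 := by simpa using hadd h₁ (hneg h₁)
  have h₁n : R (-a - a') 0 c d := by convert hneg h₁ using 1 <;> ring
  have h₃n : R a' b (-c - c') 0 := by convert hneg h₃ using 1 <;> ring
  have h₄n : R 0 b' c' (-d - d') := by convert hneg h₄ using 1 <;> ring
  have h₂n : R a (-b - b') 0 d' := by convert hadd (hadd h₁ h₃) h₄ using 1 <;> ring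
  have h₂ : R (-a) (b + b') 0 (-d') := by convert hneg h₂n using 1 <;> ring
  have d₁ := hdeg h₁
  have d₂ := hdeg h₂
  have d₃ := hdeg h₃
  have d₄ := hdeg h₄
  have main : ∀ m : ℕ, ∀ x y z w x' y' z' w' : ℤ, 0 ≤ x → 0 ≤ y → 0 ≤ z → 0 ≤ w →
      0 ≤ x' → 0 ≤ y' → 0 ≤ z' → 0 ≤ w' → x * n₀ + y * n₁ + z * n₂ + w * n₃ < m →
      x * n₀ + y * n₁ + z * n₂ + w * n₃ = x' * n₀ + y' * n₁ + z' * n₂ + w' * n₃ →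
      R (x - x') (y - y') (z - z') (w - w') := by
    intro m
    induction m with
    | zero =>
      intro x y z w x' y' z' w' hx hy hz hw _ _ _ _ hm _
      have : 0 ≤ x * n₀ + y * n₁ + z * n₂ + w * n₃ := by positivity
      simp only [Nat.cast_zero] at hm
      omega
    | succ m ih =>
      intro x y z w x' y' z' w' hx hy hz hw hx' hy' hz' hw' hm he
      push_cast at hm
      by_cases hx1 : 0 < x
      · obtain ⟨i, j, k, l, hi, hj, hk, hl, h⟩ := exists_pos_of_rewriting ha ha' hb hb' hc' hd
          hd' hF hFeq hdeg hadd h0 h₁ h₂n h₃n h₃ h₄n (w'.toNat + 1) hx' hy' hz' hw' hx1 hy hz hw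
          he (by omega)
        have hh := hdeg h
        have := ih (x - 1) y z w (i - 1) j k l (by omega) hy hz hw (by omega) hj hk hl
          (by linarith) (by linear_combination he - hh)
        convert hadd this h using 1 <;> ring
      by_cases hy1 : 0 < y
      · obtain ⟨j, k, l, i, hj, hk, hl, hi, h⟩ := exists_pos_of_rewriting (F := F)
          (R := fun p q r s => R s p q r) (n₀ := n₁) (n₁ := n₂) (n₂ := n₃) (n₃ := n₀) (c := d')
          hb hb' hc' hc hd ha ha'
          (fun p q r s hp hq hr hs h => hF s p q r hs hp hq hr (by rw [← h]; ring))
          (by linear_combination hFeq - d₂)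
          (fun h => by linear_combination hdeg h) (fun h h' => hadd h h') h0 h₂
          (by convert h₃n using 1; ring) (by convert h₄n using 1; ring)
          (by convert h₄ using 1; ring) h₁n
          (x'.toNat + 1) hy' hz' hw' hx' hy1 hz hw hx (by linear_combination he) (by omega)
        have hh := hdeg h
        have := ih x (y - 1) z w i (j - 1) k l hx (by omega) hz hw hi (by omega) hk hl
          (by linarith) (by linear_combination he - hh)
        convert hadd this h using 1 <;> ring
      by_cases hz1 : 0 < z
      · obtain ⟨k, l, i, j, hk, hl, hi, hj, h⟩ := exists_pos_of_rewriting (F := F)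
          (R := fun p q r s => R r s p q) (n₀ := n₂) (n₁ := n₃) (n₂ := n₀) (n₃ := n₁) (c := a')
          hc' hc hd hd' ha hb hb'
          (fun p q r s hp hq hr hs h => hF r s p q hr hs hp hq (by rw [← h]; ring))
          (by linear_combination hFeq - d₂ - d₃)
          (fun h => by linear_combination hdeg h) (fun h h' => hadd h h') h0
          (by convert h₃ using 1; ring)
          h₄n (by convert h₁n using 1; ring) (by convert h₁ using 1; ring) h₂n
          (y'.toNat + 1) hz' hw' hx' hy' hz1 hw hx hy (by linear_combination he) (by omega)
        have hh := hdeg h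
        have := ih x y (z - 1) w i j (k - 1) l hx hy (by omega) hw hi hj (by omega) hl
          (by linarith) (by linear_combination he - hh)
        convert hadd this h using 1 <;> ring
      by_cases hw1 : 0 < w
      · obtain ⟨l, i, j, k, hl, hi, hj, hk, h⟩ := exists_pos_of_rewriting (F := F)
          (R := fun p q r s => R q r s p) (n₀ := n₃) (n₁ := n₀) (n₂ := n₁) (n₃ := n₂) (c := b')
          hd hd' ha ha' hb hc' hc
          (fun p q r s hp hq hr hs h => hF q r s p hq hr hs hp (by rw [← h]; ring))
          (by linear_combination hFeq - d₂ - d₃ - d₄)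
          (fun h => by linear_combination hdeg h) (fun h h' => hadd h h') h0 h₄
          h₁n (by convert h₂n using 1; ring)
          (by convert h₂ using 1; ring) (by convert h₃n using 1; ring)
          (z'.toNat + 1) hw' hx' hy' hz' hw1 hx hy hz (by linear_combination he) (by omega)
        have hh := hdeg h
        have := ih x y z (w - 1) i j k (l - 1) hx hy hz (by omega) hi hj hk (by omega)
          (by linarith) (by linear_combination he - hh)
        convert hadd this h using 1 <;> ring
      obtain rfl : x = 0 := by omega
      obtain rfl : y = 0 := by omega
      obtain rfl : z = 0 := by omega
      obtain rfl : w = 0 := by omega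
      have e0 := mul_nonneg hx' hn₀.le
      have e1 := mul_nonneg hy' hn₁.le
      have e2 := mul_nonneg hz' hn₂.le
      have e3 := mul_nonneg hw' hn₃.le
      obtain rfl := (mul_eq_zero.1 (by linarith : x' * n₀ = 0)).resolve_right hn₀.ne'
      obtain rfl := (mul_eq_zero.1 (by linarith : y' * n₁ = 0)).resolve_right hn₁.ne'
      obtain rfl := (mul_eq_zero.1 (by linarith : z' * n₂ = 0)).resolve_right hn₂.ne'
      obtain rfl := (mul_eq_zero.1 (by linarith : w' * n₃ = 0)).resolve_right hn₃.ne'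
      simpa using h0
  have key : ∀ t : ℤ, max t 0 - max (-t) 0 = t := fun t => by omega
  have := main ((max x 0 * n₀ + max y 0 * n₁ + max z 0 * n₂ + max w 0 * n₃).toNat + 1)
    (max x 0) (max y 0) (max z 0) (max w 0) (max (-x) 0) (max (-y) 0) (max (-z) 0) (max (-w) 0)
    (by omega) (by omega) (by omega) (by omega) (by omega) (by omega) (by omega) (by omega)
    (by push_cast; omega)
    (by linear_combination hv + key x * n₀ + key y * n₁ + key z * n₂ + key w * n₃)
  simpa only [key] using this

end GorensteinLattice

/-- The alternating binomial sum of the monomials with exponents `u 0, …, u M`. -/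
noncomputable def altPoly (k : Type*) [Field k] (M : ℕ) (u : ℕ → Fin 4 → ℤ) :
    MvPolynomial (Fin 4) k :=
  ∑ j ∈ Finset.range (M + 1),
    (-1) ^ j * (M.choose j : MvPolynomial (Fin 4) k) * ∏ i, MvPolynomial.X i ^ (u j i).toNat

section AltPoly

variable {k : Type*} [Field k] {M : ℕ} {u : ℕ → Fin 4 → ℤ}

theorem aeval_altPoly {A : Type*} [CommRing A] [Algebra k A] (a : Fin 4 → A) :
    MvPolynomial.aeval a (altPoly k M u) =
      ∑ j ∈ Finset.range (M + 1), (-1) ^ j * (M.choose j : A) * ∏ i, a i ^ (u j i).toNat := by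
  simp [altPoly, map_sum, map_prod]

theorem sum_neg_one_pow_choose_mul_pow {A : Type*} [CommRing A] (M : ℕ) (θ : A) :
    ∑ j ∈ Finset.range (M + 1), (-1) ^ j * (M.choose j : A) * θ ^ j = (1 - θ) ^ M := by
  rw [sub_eq_neg_add, add_pow]
  refine Finset.sum_congr rfl fun j _ => ?_
  rw [one_pow, neg_pow]
  ring

theorem aeval_X_pow_altPoly {n : Fin 4 → ℕ} (hM : M ≠ 0) (hu : ∀ j ≤ M, ∀ i, 0 ≤ u j i)
    (hdeg : ∀ j ≤ M, ∑ i, u j i * (n i : ℤ) = ∑ i, u 0 i * (n i : ℤ)) :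
    MvPolynomial.aeval (fun i => (X : k[X]) ^ n i) (altPoly k M u) = 0 := by
  have hmon : ∀ j ≤ M, ∏ i, ((X : k[X]) ^ n i) ^ (u j i).toNat =
      X ^ (∑ i, u 0 i * (n i : ℤ)).toNat * 1 ^ j := by
    intro j hj
    simp only [← pow_mul, Finset.prod_pow_eq_pow_sum, one_pow, mul_one]
    congr 1
    zify
    rw [Int.toNat_of_nonneg (Finset.sum_nonneg fun i _ =>
      mul_nonneg (hu 0 (Nat.zero_le _) i) (Int.natCast_nonneg _)), ← hdeg j hj]
    exact Finset.sum_congr rfl fun i _ => by rw [Int.toNat_of_nonneg (hu j hj i), mul_comm]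
  rw [aeval_altPoly]
  calc _ = X ^ (∑ i, u 0 i * (n i : ℤ)).toNat *
        ∑ j ∈ Finset.range (M + 1), (-1) ^ j * (M.choose j : k[X]) * 1 ^ j := by
        rw [Finset.mul_sum]
        refine Finset.sum_congr rfl fun j hj => ?_
        rw [hmon j (by simpa [Nat.lt_succ_iff] using hj)]
        ring
    _ = 0 := by rw [sum_neg_one_pow_choose_mul_pow, sub_self, zero_pow hM, mul_zero]

variable {K : Type*} [Field K] [Algebra k K] {a : Fin 4 → K}

theorem prod_pow_toNat_eq_prod_zpow {v : Fin 4 → ℤ} (hv : ∀ i, 0 ≤ v i) :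
    ∏ i, a i ^ (v i).toNat = ∏ i, a i ^ v i :=
  Finset.prod_congr rfl fun i _ => by rw [← zpow_natCast, Int.toNat_of_nonneg (hv i)]

theorem prod_zpow_eq_one_of_aeval_altPoly (ha : ∀ i, a i ≠ 0) (hu : ∀ j ≤ M, ∀ i, 0 ≤ u j i)
    {ρ : Fin 4 → ℤ} {s : ℕ → Fin 4 → ℤ} (hs : ∀ j ≤ M, ∏ i, a i ^ s j i = 1)
    (hus : ∀ j ≤ M, u j = u 0 + (j : ℤ) • ρ + s j)
    (h : MvPolynomial.aeval a (altPoly k M u) = 0) : ∏ i, a i ^ ρ i = 1 := by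
  have hmon : ∀ j ≤ M, ∏ i, a i ^ (u j i).toNat = (∏ i, a i ^ u 0 i) * (∏ i, a i ^ ρ i) ^ j := by
    intro j hj
    rw [prod_pow_toNat_eq_prod_zpow (hu j hj), hus j hj, prod_zpow_add ha, prod_zpow_add ha,
      prod_zpow_smul, hs j hj, mul_one, zpow_natCast]
  have h' : (∏ i, a i ^ u 0 i) * (1 - ∏ i, a i ^ ρ i) ^ M = 0 := by
    rw [← h, aeval_altPoly, ← sum_neg_one_pow_choose_mul_pow, Finset.mul_sum]
    refine Finset.sum_congr rfl fun j hj => ?_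
    rw [hmon j (by simpa [Nat.lt_succ_iff] using hj)]
    ring
  have h0 : (∏ i, a i ^ u 0 i) ≠ 0 := Finset.prod_ne_zero_iff.2 fun i _ => zpow_ne_zero _ (ha i)
  exact (sub_eq_zero.1 (eq_zero_of_pow_eq_zero ((mul_eq_zero.1 h').resolve_left h0))).symm

theorem exists_eq_zero_of_aeval_altPoly {j₀ : ℕ} (hj₀ : j₀ ≤ M) (hch : M.choose j₀ = 1)
    (hz : ∀ j ≤ M, j ≠ j₀ → ∃ i, a i = 0 ∧ 0 < u j i)
    (h : MvPolynomial.aeval a (altPoly k M u) = 0) : ∃ i, a i = 0 ∧ 0 < u j₀ i := by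
  rw [aeval_altPoly, Finset.sum_eq_single j₀] at h
  · rw [hch, Nat.cast_one, mul_one] at h
    have := (mul_eq_zero.1 h).resolve_left (pow_ne_zero _ (by simp))
    obtain ⟨i, -, hi⟩ := Finset.prod_eq_zero_iff.1 this
    obtain ⟨h0, h1⟩ := pow_eq_zero_iff'.1 hi
    exact ⟨i, h0, by omega⟩
  · intro j hj hne
    obtain ⟨i, h0, h1⟩ := hz j (by simpa [Nat.lt_succ_iff] using hj) hne
    rw [Finset.prod_eq_zero (Finset.mem_univ i), mul_zero]
    rw [h0, zero_pow (by omega)]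
  · simp [hj₀]

end AltPoly

theorem exists_ceil_div (D e : ℤ) (hD : 0 < D) : ∃ t : ℤ, e ≤ D * t ∧ D * t < e + D := by
  refine ⟨(e + D - 1) / D, ?_, ?_⟩
  · have := Int.mul_ediv_add_emod (e + D - 1) D
    have := Int.emod_lt_of_pos (e + D - 1) hD
    omega
  · have := Int.mul_ediv_add_emod (e + D - 1) D
    have := Int.emod_nonneg (e + D - 1) hD.ne'
    omega

section Families

variable {a a' b b' c c' d d' : ℤ}

theorem exists_first_family (ha : 0 < a) (ha' : 0 < a') (hb : 0 < b) (hc : 0 < c) (hc' : 0 < c')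
    (hd : 0 < d) :
    ∃ (M : ℕ) (u : ℕ → Fin 4 → ℤ) (m : ℕ → ℤ), M ≠ 0 ∧ (∀ j ≤ M, ∀ i, 0 ≤ u j i) ∧
      (∀ j ≤ M, u j = u 0 + (j : ℤ) • ![a + a', 0, -c, -d] + m j • ![-a', -b, c + c', 0]) ∧
      u 0 0 = 0 ∧ u 0 2 = 0 ∧ (∀ j ≤ M, j ≠ 0 → 0 < u j 0) ∧
      (∀ j ≤ M, j ≠ M → 0 < u j 3 ∧ (0 < u j 1 ∨ 0 < u j 2)) ∧
      u M 1 = 0 ∧ u M 2 = 0 ∧ u M 3 = 0 := by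
  choose m hm₁ hm₂ using fun j : ℕ => exists_ceil_div (c + c') (c * j) (by omega)
  have hM : (((c + c').toNat : ℕ) : ℤ) = c + c' := Int.toNat_of_nonneg (by omega)
  set M := (c + c').toNat
  have hmc : ∀ j ≤ M, m j ≤ c := by
    intro j hj
    have hj : (j : ℤ) ≤ c + c' := by omega
    have := hm₂ j
    by_contra! h
    nlinarith
  have hmj : ∀ j, m j ≤ j := by
    intro j
    have := hm₂ j
    by_contra! h
    nlinarith
  have hm0 : m 0 = 0 := by
    have h1 := hm₁ 0
    have h2 := hm₂ 0
    push_cast at h1 h2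
    have : m 0 < 1 := by by_contra! h; nlinarith
    have : -1 < m 0 := by by_contra! h; nlinarith
    omega
  have hmM : m M = c := by
    refine le_antisymm (hmc M le_rfl) ?_
    have h1 := hm₁ M
    by_contra! h
    rw [hM] at h1
    nlinarith
  refine ⟨M, fun j => ![(a + a') * j - m j * a', (c - m j) * b, m j * (c + c') - c * j,
    (c + c' - j) * d], m, by omega, ?_, ?_, ?_, ?_, ?_, ?_, ?_, ?_, ?_⟩
  · intro j hj
    have h1 := hmc j hj
    have h2 := hmj j
    have h3 := hm₁ j
    refine forall_fin_four.2 ⟨?_, ?_, ?_, ?_⟩ <;> simp only [Matrix.cons_val]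
    · nlinarith
    · exact mul_nonneg (by omega) hb.le
    · linarith
    · exact mul_nonneg (by omega) hd.le
  · intro j hj
    funext i
    fin_cases i <;> simp [hm0] <;> ring
  · simp [hm0]
  · simp [hm0]
  · intro j hj hj0
    have h2 := hmj j
    have h3 : (1 : ℤ) ≤ j := by omega
    simp only [Matrix.cons_val]
    nlinarith
  · intro j hj hjM
    have h1 := hmc j hj
    have h3 : (j : ℤ) < c + c' := by omega
    simp only [Matrix.cons_val]
    refine ⟨mul_pos (by omega) hd, ?_⟩
    rcases h1.lt_or_eq with h | h
    · exact .inl (mul_pos (by omega) hb)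
    · right
      rw [h]
      nlinarith
  · simp [hmM]
  · simp [hmM, hM]
  · simp [hM]

theorem exists_second_family (ha : 0 < a) (ha' : 0 < a') (hb : 0 < b) (hb' : 0 < b')
    (hc : 0 < c) (hc' : 0 < c') (hd : 0 < d) (hd' : 0 < d') :
    ∃ (M : ℕ) (u : ℕ → Fin 4 → ℤ) (p q : ℕ → ℤ), M ≠ 0 ∧ (∀ j ≤ M, ∀ i, 0 ≤ u j i) ∧
      (∀ j ≤ M, u j = u 0 + (j : ℤ) • ![0, b', c', -(d + d')] +
        (p j • ![a + a', 0, -c, -d] + q j • ![-a', -b, c + c', 0])) ∧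
      u 0 0 = 0 ∧ u 0 1 = 0 ∧ u 0 2 = 0 ∧ (∀ j ≤ M, j ≠ 0 → 0 < u j 1) ∧
      (∀ j ≤ M, j ≠ M → 0 < u j 3) ∧ u M 0 = 0 ∧ u M 2 = 0 ∧ u M 3 = 0 := by
  obtain ⟨D, hD⟩ : ∃ D, D = c * a + c' * a + c' * a' := ⟨_, rfl⟩
  obtain ⟨k, hk⟩ : ∃ k, k = (c * b + 1) * (d + d') := ⟨_, rfl⟩
  have hD0 : 0 < D := by rw [hD]; positivity
  have hcb : 0 < c * b := by positivity
  have hk0 : c * b < k := by rw [hk]; nlinarith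
  have hkD : c * b < k * D := by nlinarith
  obtain ⟨B, hB⟩ : ∃ B, B = D * d' + (c + c') * a * d := ⟨_, rfl⟩
  have hB0 : 0 < B := by rw [hB]; positivity
  have hkB : (c * b + 1) * (d + d') ≤ k * B := by rw [← hk]; nlinarith
  choose t ht₁ ht₂ using fun j : ℕ => exists_ceil_div D (a * j) hD0
  have hM : (((k * D).toNat : ℕ) : ℤ) = k * D := Int.toNat_of_nonneg (by omega)
  set M := (k * D).toNat
  have hta : ∀ j ≤ M, t j ≤ a * k := by
    intro j hj
    have hj : (j : ℤ) ≤ k * D := by omega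
    have := ht₂ j
    have h3 : a * j ≤ a * (k * D) := mul_le_mul_of_nonneg_left hj ha.le
    by_contra! h
    nlinarith
  have htM : t M = a * k := by
    refine le_antisymm (hta M le_rfl) ?_
    have := ht₁ M
    rw [hM] at this
    by_contra! h
    nlinarith
  have hy : ∀ j : ℕ, c * b < j → 0 < (b + b') * j - c * b * t j := by
    intro j hj
    have h2 := ht₂ j
    have h3 : c * b * (D * t j) ≤ c * b * (a * j + D) := mul_le_mul_of_nonneg_left h2.le hcb.le
    have h4 : c * b * D ≤ b' * j * D := by
      have : c * b ≤ b' * j := by nlinarith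
      exact mul_le_mul_of_nonneg_right this hD0.le
    have h5 : 0 < b * j * (c' * a + c' * a') :=
      mul_pos (mul_pos hb (by omega)) (by positivity)
    have h6 : 0 < D * ((b + b') * j - c * b * t j) := by
      have : b * j * D = b * j * (c * a) + b * j * (c' * a + c' * a') := by rw [hD]; ring
      linarith
    exact pos_of_mul_pos_right h6 hD0.le
  refine ⟨M, fun j => if (j : ℤ) ≤ c * b then ![0, j * b', j * c', k * B - j * (d + d')]
    else ![D * t j - a * j, (b + b') * j - c * b * t j, 0,
      d' * (k * D - j) + (c + c') * d * (a * k - t j)],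
    fun j => if (j : ℤ) ≤ c * b then 0 else (c + c') * t j - j,
    fun j => if (j : ℤ) ≤ c * b then 0 else c * t j - j, by omega, ?_, ?_, ?_⟩
  · intro j hj
    beta_reduce
    split_ifs with h
    · refine forall_fin_four.2 ⟨?_, ?_, ?_, ?_⟩ <;> simp only [Matrix.cons_val]
      · rfl
      · positivity
      · positivity
      · nlinarith
    · have h1 := hta j hj
      have h3 := ht₁ j
      have h4 := hy j (by omega)
      refine forall_fin_four.2 ⟨?_, ?_, ?_, ?_⟩ <;> simp only [Matrix.cons_val]
      · linarith
      · exact h4.le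
      · rfl
      · have := mul_nonneg hd'.le (by omega : 0 ≤ k * D - j)
        have := mul_nonneg (by positivity : 0 ≤ (c + c') * d) (by omega : 0 ≤ a * k - t j)
        linarith
  · intro j hj
    beta_reduce
    rw [if_pos (show ((0 : ℕ) : ℤ) ≤ c * b by push_cast; omega)]
    split_ifs with h
    · funext i
      fin_cases i <;> simp <;> ring
    · funext i
      fin_cases i <;> simp [hB, hD] <;> ring
  · beta_reduce
    rw [if_pos (show ((0 : ℕ) : ℤ) ≤ c * b by push_cast; omega),
      if_neg (show ¬ (M : ℤ) ≤ c * b by omega)]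
    refine ⟨by simp, by simp, by simp, fun j hj hj0 => ?_, fun j hj hjM => ?_,
      by simp [htM, hM]; ring, by simp, by simp [htM, hM]⟩
    · have : 0 < (j : ℤ) := by omega
      split_ifs with h
      · simpa using mul_pos this hb'
      · simpa using hy j (by omega)
    · split_ifs with h
      · simp only [Matrix.cons_val]
        nlinarith
      · have h1 := hta j hj
        have := mul_pos hd' (by omega : 0 < k * D - j)
        have := mul_nonneg (by positivity : 0 ≤ (c + c') * d) (by omega : 0 ≤ a * k - t j)
        simp only [Matrix.cons_val]
        linarith

end Families

theorem IsCutOut.of_gorenstein {k : Type*} [Field k] {n : Fin 4 → ℕ} (hpos : ∀ i, 0 < n i)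
    {F : ℤ} (hF : ∀ u : Fin 4 → ℤ, (∀ i, 0 ≤ u i) → ∑ i, u i * (n i : ℤ) ≠ F)
    {a a' b b' c c' d d' : ℤ} (ha : 0 < a) (ha' : 0 < a') (hb : 0 < b) (hb' : 0 < b')
    (hc : 0 < c) (hc' : 0 < c') (hd : 0 < d) (hd' : 0 < d')
    (h₁ : (a + a') * n 0 = c * n 2 + d * n 3) (h₃ : (c + c') * n 2 = a' * n 0 + b * n 1)
    (h₄ : (d + d') * n 3 = b' * n 1 + c' * n 2)
    (hFeq : -(n 0 : ℤ) + (b + b' - 1) * n 1 + (c + c' - 1) * n 2 + (d - 1) * n 3 = F) :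
    IsCutOut k n := by
  obtain ⟨M, u, m, hM, hu, hus, hu00, hu02, hux, huw, huM1, huM2, huM3⟩ :=
    exists_first_family ha ha' hb hc hc' hd
  obtain ⟨M', u', p, q, hM', hu', hus', hu'00, hu'01, hu'02, huy', huw', huM0', huM2', huM3'⟩ :=
    exists_second_family ha ha' hb hb' hc hc' hd hd'
  let g : ℕ → Fin 4 → ℤ := fun j => if j = 0 then ![0, 0, c + c', 0] else ![a', b, 0, 0]
  have hg : ∀ j ≤ 1, ∀ i, 0 ≤ g j i := by
    intro j _
    simp only [g]
    split_ifs
    · refine forall_fin_four.2 ⟨?_, ?_, ?_, ?_⟩ <;> simp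
      omega
    · refine forall_fin_four.2 ⟨?_, ?_, ?_, ?_⟩ <;> simp <;> omega
  refine ⟨![altPoly k 1 g, altPoly k M u, altPoly k M' u'], ?_, ?_⟩
  · intro s
    fin_cases s
    · refine aeval_X_pow_altPoly one_ne_zero hg fun j hj => ?_
      simp only [g]
      split_ifs
      · simp
      · simp [Fin.sum_univ_four]
        linarith
    · refine aeval_X_pow_altPoly hM hu fun j hj => ?_
      rw [hus j hj]
      simp only [Fin.sum_univ_four, Pi.add_apply, Pi.smul_apply, Matrix.cons_val, smul_eq_mul]
      linear_combination j * h₁ + m j * h₃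
    · refine aeval_X_pow_altPoly hM' hu' fun j hj => ?_
      rw [hus' j hj]
      simp only [Fin.sum_univ_four, Pi.add_apply, Pi.smul_apply, Matrix.cons_val, smul_eq_mul]
      linear_combination p j * h₁ + q j * h₃ - j * h₄
  · intro K _ _ x hx
    have e₁ : MvPolynomial.aeval x (altPoly k 1 g) = 0 := hx 0
    have e₂ : MvPolynomial.aeval x (altPoly k M u) = 0 := hx 1
    have e₃ : MvPolynomial.aeval x (altPoly k M' u') = 0 := hx 2
    by_cases h0 : ∀ i, x i ≠ 0
    · refine .inr ⟨h0, fun v hv => ?_⟩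
      have t₃ : ∏ i, x i ^ (![a', b, -(c + c'), 0] : Fin 4 → ℤ) i = 1 := by
        refine prod_zpow_eq_one_of_aeval_altPoly h0 hg (s := fun _ => 0) (by simp) ?_ e₁
        intro j hj
        obtain rfl | rfl : j = 0 ∨ j = 1 := by omega
        · simp
        · funext i
          fin_cases i <;> simp [g]
      have t₃' : ∏ i, x i ^ (![-a', -b, c + c', 0] : Fin 4 → ℤ) i = 1 := by
        have := prod_zpow_smul (a := x) (-1) ![a', b, -(c + c'), 0]
        rw [t₃, one_zpow] at this
        rw [← this]
        congr 1
        funext i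
        fin_cases i <;> simp
      have t₁ := prod_zpow_eq_one_of_aeval_altPoly h0 hu (fun j _ => by
        rw [prod_zpow_smul, t₃', one_zpow]) hus e₂
      have t₄ := prod_zpow_eq_one_of_aeval_altPoly h0 hu' (fun j _ => by
        rw [prod_zpow_add h0, prod_zpow_smul, prod_zpow_smul, t₃', t₁, one_zpow, one_zpow,
          one_mul]) hus' e₃
      have key := relation_of_degree_eq_zero (n₀ := n 0) (n₁ := n 1) (n₂ := n 2) (n₃ := n 3)
        (F := F) (R := fun p q r s => p * n 0 + q * n 1 + r * n 2 + s * n 3 = 0 ∧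
          x 0 ^ p * x 1 ^ q * x 2 ^ r * x 3 ^ s = 1)
        (x := v 0) (y := v 1) (z := v 2) (w := v 3)
        (mod_cast hpos 0) (mod_cast hpos 1) (mod_cast hpos 2) (mod_cast hpos 3)
        ha ha' hb hb' hc hc' hd hd'
        (fun p q r s hp hq hr hs => by
          have := hF ![p, q, r, s] (forall_fin_four.2 ⟨hp, hq, hr, hs⟩)
          simpa [Fin.sum_univ_four] using this)
        hFeq (fun h => h.1)
        (fun h h' => ⟨by linear_combination h.1 + h'.1, by
          rw [zpow_add₀ (h0 0), zpow_add₀ (h0 1), zpow_add₀ (h0 2), zpow_add₀ (h0 3)]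
          refine Eq.trans ?_ ((congrArg₂ (· * ·) h.2 h'.2).trans (one_mul 1))
          ring⟩)
        (fun h => ⟨by linear_combination -h.1, by
          simp only [zpow_neg, ← mul_inv, h.2, inv_one]⟩)
        ⟨by linear_combination h₁, by simpa [Fin.prod_univ_four] using t₁⟩
        ⟨by linear_combination h₃, by simpa [Fin.prod_univ_four] using t₃'⟩
        ⟨by linear_combination h₄, by
          have := congrArg (·⁻¹) t₄
          simp only [inv_one, Fin.prod_univ_four, mul_inv, ← zpow_neg] at this
          simpa using this⟩
        (by simpa [Fin.sum_univ_four] using hv)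
      simpa [Fin.prod_univ_four] using key.2
    · push Not at h0
      left
      have g₀ : (∃ i, x i = 0 ∧ 0 < g 1 i) → x 2 = 0 := by
        intro h
        obtain ⟨i, hi, hi'⟩ := exists_eq_zero_of_aeval_altPoly (Nat.zero_le 1) rfl
          (fun j hj hj0 => by obtain rfl : j = 1 := by omega
                              exact h) e₁
        fin_cases i <;> simp [g] at hi hi'
        exact hi
      have g₁ : x 2 = 0 → x 0 = 0 ∨ x 1 = 0 := by
        intro h
        obtain ⟨i, hi, hi'⟩ := exists_eq_zero_of_aeval_altPoly (j₀ := 1) le_rfl rfl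
          (fun j hj hj0 => by obtain rfl : j = 0 := by omega
                              exact ⟨2, h, by simp [g]; omega⟩) e₁
        fin_cases i <;> simp [g] at hi hi'
        exacts [.inl hi, .inr hi]
      have x0 : x 0 = 0 := by
        by_contra hne
        obtain ⟨i, hi, hi'⟩ := exists_eq_zero_of_aeval_altPoly le_rfl (Nat.choose_self M)
          (fun j hj hjM => by
            obtain ⟨h3, h12⟩ := huw j hj hjM
            by_cases hx3 : x 3 = 0
            · exact ⟨3, hx3, h3⟩
            have hx1 : x 1 = 0 := by
              obtain ⟨i, hi⟩ := h0
              fin_cases i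
              · exact absurd hi hne
              · exact hi
              · exact (g₁ hi).resolve_left hne
              · exact absurd hi hx3
            have hx2 : x 2 = 0 := g₀ ⟨1, hx1, by simpa [g] using hb⟩
            rcases h12 with h | h
            · exact ⟨1, hx1, h⟩
            · exact ⟨2, hx2, h⟩) e₂
        fin_cases i
        · exact hne hi
        · exact hi'.ne' huM1
        · exact hi'.ne' huM2
        · exact hi'.ne' huM3
      have x2 : x 2 = 0 := g₀ ⟨0, x0, by simpa [g] using ha'⟩
      have y0 : x 1 = 0 → x 3 = 0 := by
        intro h
        obtain ⟨i, hi, hi'⟩ := exists_eq_zero_of_aeval_altPoly (Nat.zero_le M')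
          (Nat.choose_zero_right M') (fun j hj hj0 => ⟨1, h, huy' j hj hj0⟩) e₃
        fin_cases i
        · exact absurd hu'00 hi'.ne'
        · exact absurd hu'01 hi'.ne'
        · exact absurd hu'02 hi'.ne'
        · exact hi
      have w0 : x 3 = 0 → x 1 = 0 := by
        intro h
        obtain ⟨i, hi, hi'⟩ := exists_eq_zero_of_aeval_altPoly le_rfl
          (Nat.choose_self M') (fun j hj hj0 => ⟨3, h, huw' j hj hj0⟩) e₃
        fin_cases i
        · exact absurd huM0' hi'.ne'
        · exact hi
        · exact absurd huM2' hi'.ne'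
        · exact absurd huM3' hi'.ne'
      obtain ⟨i, hi, hi'⟩ := exists_eq_zero_of_aeval_altPoly (Nat.zero_le M)
        (Nat.choose_zero_right M) (fun j hj hj0 => ⟨0, x0, hux j hj hj0⟩) e₂
      have hyw : x 1 = 0 ∧ x 3 = 0 := by
        fin_cases i
        · exact absurd hu00 hi'.ne'
        · exact ⟨hi, y0 hi⟩
        · exact absurd hu02 hi'.ne'
        · exact ⟨w0 hi, hi⟩
      exact forall_fin_four.2 ⟨x0, hyw.1, x2, hyw.2⟩

/-- The degree of the Laurent monomial with exponent vector `u`. -/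
def weight (n : Fin 4 → ℕ) (u : Fin 4 → ℤ) : ℤ := ∑ i, u i * (n i : ℤ)

/-- The numbers `n i` have gcd `1` and generate a semigroup that is symmetric about `F`;
the number `c i` is the least positive one with `c i * n i` generated by the other `n j`. -/
structure IsSymmetricAbout (n : Fin 4 → ℕ) (F : ℤ) (c : Fin 4 → ℤ) : Prop where
  pos : ∀ i, 0 < n i
  gcd : ∀ d : ℕ, (∀ i, d ∣ n i) → d = 1
  weight_ne : ∀ u, (∀ i, 0 ≤ u i) → weight n u ≠ F
  dichotomy : ∀ m : ℤ, (∃ u, (∀ i, 0 ≤ u i) ∧ weight n u = m) ∨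
    ∃ u, (∀ i, 0 ≤ u i) ∧ weight n u = F - m
  crit_pos : ∀ i, 0 < c i
  crit_rep : ∀ i, ∃ u, (∀ j, 0 ≤ u j) ∧ u i = 0 ∧ weight n u = c i * n i
  crit_min : ∀ i e u, 0 < e → (∀ j, 0 ≤ u j) → u i = 0 → weight n u = e * n i → c i ≤ e

/-- The variable `i` occurs in a representation of `c j * n j` by the other generators. -/
def Occurs (n : Fin 4 → ℕ) (c : Fin 4 → ℤ) (j i : Fin 4) : Prop :=
  i ≠ j ∧ ∃ u, (∀ p, 0 ≤ u p) ∧ weight n u = c j * n j ∧ 0 < u i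

/-- The vector `u` is a factorization of `F` that is `-1` at `i` and nonnegative elsewhere. -/
def IsGap (n : Fin 4 → ℕ) (F : ℤ) (i : Fin 4) (u : Fin 4 → ℤ) : Prop :=
  u i = -1 ∧ (∀ j, j ≠ i → 0 ≤ u j) ∧ weight n u = F

section Weight

variable {n : Fin 4 → ℕ}

theorem weight_add (u v : Fin 4 → ℤ) : weight n (u + v) = weight n u + weight n v := by
  simp [weight, add_mul, Finset.sum_add_distrib]

theorem weight_sub (u v : Fin 4 → ℤ) : weight n (u - v) = weight n u - weight n v := by
  simp [weight, sub_mul, Finset.sum_sub_distrib]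

theorem weight_single (i : Fin 4) (e : ℤ) : weight n (Pi.single i e) = e * n i := by
  simp [weight, Pi.single_apply]

theorem weight_eq (u : Fin 4 → ℤ) :
    weight n u = u 0 * n 0 + u 1 * n 1 + u 2 * n 2 + u 3 * n 3 := Fin.sum_univ_four _

theorem weight_mono {u v : Fin 4 → ℤ} (h : ∀ i, u i ≤ v i) : weight n u ≤ weight n v :=
  Finset.sum_le_sum fun i _ => mul_le_mul_of_nonneg_right (h i) (Int.natCast_nonneg _)

theorem weight_comp (σ : Equiv.Perm (Fin 4)) (u : Fin 4 → ℤ) :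
    weight (n ∘ σ) (u ∘ σ) = weight n u :=
  Equiv.sum_comp σ fun i => u i * (n i : ℤ)

theorem weight_comp_eq (σ : Equiv.Perm (Fin 4)) (u : Fin 4 → ℤ) :
    weight (n ∘ σ) u = weight n (u ∘ σ.symm) := by
  rw [← weight_comp σ (u ∘ σ.symm), Function.comp_assoc, Equiv.symm_comp_self, Function.comp_id]

/-- A factorization of `e * n j` using a variable other than `j` uses `j` fewer than `e` times. -/
theorem lt_of_weight_eq (hpos : ∀ i, 0 < n i) {u : Fin 4 → ℤ} (hu : ∀ p, 0 ≤ u p)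
    {i j : Fin 4} (hij : i ≠ j) (hi : 0 < u i) {e : ℤ} (he : weight n u = e * n j) : u j < e := by
  have h : weight n (Pi.single i 1 + Pi.single j (u j)) ≤ weight n u := by
    refine weight_mono fun p => ?_
    rcases eq_or_ne p i with rfl | hpi
    · simp [hij]; omega
    · rcases eq_or_ne p j with rfl | hpj
      · simp [hpi]
      · simpa [hpi, hpj] using hu p
  rw [weight_add, weight_single, weight_single, he] at h
  have hi := hpos i
  have hj := hpos j
  zify at hi hj
  by_contra! hle
  nlinarith

end Weight

namespace IsSymmetricAbout

variable {n : Fin 4 → ℕ} {F : ℤ} {c : Fin 4 → ℤ}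

theorem comp (D : IsSymmetricAbout n F c) (σ : Equiv.Perm (Fin 4)) :
    IsSymmetricAbout (n ∘ σ) F (c ∘ σ) := by
  refine ⟨fun i => D.pos _, fun d hd => D.gcd d fun i => by simpa using hd (σ.symm i),
    fun u hu => ?_, fun m => ?_, fun i => D.crit_pos _, fun i => ?_, fun i e u he hu hi h => ?_⟩
  · rw [weight_comp_eq]
    exact D.weight_ne _ fun i => hu _
  · rcases D.dichotomy m with ⟨u, hu, h⟩ | ⟨u, hu, h⟩
    · exact .inl ⟨u ∘ σ, fun i => hu _, by rw [weight_comp, h]⟩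
    · exact .inr ⟨u ∘ σ, fun i => hu _, by rw [weight_comp, h]⟩
  · obtain ⟨u, hu, hi, h⟩ := D.crit_rep (σ i)
    exact ⟨u ∘ σ, fun i => hu _, hi, by rw [weight_comp, h]; rfl⟩
  · exact D.crit_min (σ i) e (u ∘ σ.symm) he (fun i => hu _) (by simpa using hi)
      (by rw [← weight_comp_eq, h]; rfl)

theorem occurs_comp (σ : Equiv.Perm (Fin 4)) {j i : Fin 4} :
    Occurs (n ∘ σ) (c ∘ σ) j i ↔ Occurs n c (σ j) (σ i) := by
  constructor
  · rintro ⟨hij, u, hu, h, hi⟩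
    exact ⟨by simpa using hij, u ∘ σ.symm, fun i => hu _, by rw [← weight_comp_eq, h]; rfl,
      by simpa using hi⟩
  · rintro ⟨hij, u, hu, h, hi⟩
    exact ⟨by simpa using hij, u ∘ σ, fun i => hu _, by rw [weight_comp, h]; rfl, hi⟩

theorem crit_le_sub (D : IsSymmetricAbout n F c) {j : Fin 4} {e : ℤ} {u : Fin 4 → ℤ}
    (hu : ∀ p, 0 ≤ u p) (h : weight n u = e * n j) (hlt : u j < e) : c j ≤ e - u j := by
  refine D.crit_min j _ (u - Pi.single j (u j)) (by omega) (fun p => ?_) (by simp) ?_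
  · rcases eq_or_ne p j with rfl | hp
    · simp
    · simpa [hp] using hu p
  · rw [weight_sub, weight_single, h]
    ring

/-- A factorization of `c j * n j` involving another variable does not involve `j`. -/
theorem eq_zero_of_pos (D : IsSymmetricAbout n F c) {i j : Fin 4} (hij : i ≠ j)
    {u : Fin 4 → ℤ} (hu : ∀ p, 0 ≤ u p) (h : weight n u = c j * n j) (hi : 0 < u i) : u j = 0 := by
  have := D.crit_le_sub hu h (lt_of_weight_eq D.pos hu hij hi h)
  have := hu j
  omega

theorem gap_sub_add (D : IsSymmetricAbout n F c) {i : Fin 4} {u u' m : Fin 4 → ℤ}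
    (hu : IsGap n F i u) (hmi : m i = 0)
    (hm : ∀ j, j ≠ i → m j ≤ u j) (hu' : ∀ j, 0 ≤ u' j) (h : weight n u' = weight n m) :
    IsGap n F i (u - m + u') := by
  have hw : weight n (u - m + u') = F := by
    rw [weight_add, weight_sub, h, hu.2.2]
    ring
  have hoff : ∀ j, j ≠ i → 0 ≤ (u - m + u') j := by
    intro j hj
    have := hm j hj
    have := hu' j
    simp only [Pi.add_apply, Pi.sub_apply]
    omega
  refine ⟨?_, hoff, hw⟩
  have hi := hu' i
  have := hu.1
  by_contra hne
  refine D.weight_ne (u - m + u') (fun j => ?_) hw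
  rcases eq_or_ne j i with rfl | hj
  · simp only [Pi.add_apply, Pi.sub_apply] at hne ⊢
    omega
  · exact hoff j hj

theorem exists_gap_or (D : IsSymmetricAbout n F c) {i : Fin 4} {m : Fin 4 → ℤ}
    (hm : ∀ j, 0 ≤ m j) (hmi : m i = 0) :
    (∃ u, (∀ j, 0 ≤ u j) ∧ weight n u = weight n m ∧ 0 < u i) ∨
      ∃ u, IsGap n F i u ∧ ∀ j, j ≠ i → m j ≤ u j := by
  rcases D.dichotomy (weight n m - n i) with ⟨u, hu, h⟩ | ⟨u, hu, h⟩
  · refine .inl ⟨u + Pi.single i 1, fun j => ?_, ?_, ?_⟩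
    · have := hu j
      rcases eq_or_ne j i with rfl | hj
      · simp; omega
      · simpa [hj] using this
    · rw [weight_add, weight_single, h]
      ring
    · have := hu i
      simp
      omega
  · have hw : weight n (u + m - Pi.single i 1) = F := by
      rw [weight_sub, weight_add, weight_single, h]
      ring
    have hoff : ∀ j, j ≠ i → (u + m - Pi.single i 1 : Fin 4 → ℤ) j = u j + m j :=
      fun j hj => by simp [hj]
    have hi : (u + m - Pi.single i 1 : Fin 4 → ℤ) i = -1 := by
      have h0 := hu i
      by_contra hne
      refine D.weight_ne _ (fun j => ?_) hw
      rcases eq_or_ne j i with rfl | hj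
      · simp [hmi] at hne ⊢
        omega
      · rw [hoff j hj]
        exact add_nonneg (hu j) (hm j)
    refine .inr ⟨_, ⟨hi, fun j hj => ?_, hw⟩, fun j hj => ?_⟩
    · rw [hoff j hj]
      exact add_nonneg (hu j) (hm j)
    · rw [hoff j hj]
      have := hu j
      omega

theorem exists_gap_crit_le (D : IsSymmetricAbout n F c) {i j : Fin 4} (hij : j ≠ i) :
    ∃ u, IsGap n F i u ∧ c j - 1 ≤ u j := by
  have hc := D.crit_pos j
  rcases D.exists_gap_or (i := i) (m := Pi.single j (c j - 1)) (fun p => by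
    rcases eq_or_ne p j with rfl | hp
    · simp; omega
    · simp [hp]) (by simp [hij.symm]) with ⟨u, hu, h, hi⟩ | ⟨u, hu, h⟩
  · rw [weight_single] at h
    have := D.crit_le_sub hu h (lt_of_weight_eq D.pos hu hij.symm hi h)
    have := hu j
    omega
  · exact ⟨u, hu, by simpa using h j hij⟩

theorem gap_lt_crit (D : IsSymmetricAbout n F c) {i j : Fin 4} (hO : Occurs n c j i)
    {u : Fin 4 → ℤ} (hu : IsGap n F i u) : u j < c j := by
  obtain ⟨hij, v, hv, h, hi⟩ := hO
  by_contra! hle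
  have := (D.gap_sub_add hu (m := Pi.single j (c j)) (by simp [hij])
    (fun p hp => by
      rcases eq_or_ne p j with rfl | hpj
      · simpa using hle
      · simpa [hpj] using hu.2.1 p hp) hv (by rw [h, weight_single])).1
  simp [hij, hu.1] at this
  omega

/-- Two factorizations of `F` with a gap at `i` differ by a critical relation of some `j`
that does not involve `i`. -/
theorem exists_unique_pos_of_gap_ne (D : IsSymmetricAbout n F c) {i : Fin 4}
    {u u' : Fin 4 → ℤ} (hu : IsGap n F i u) (hu' : IsGap n F i u') (hne : u ≠ u') :
    ∃ j, j ≠ i ∧ ¬ Occurs n c j i ∧ ((u' j < u j ∧ ∀ p, p ≠ j → u p ≤ u' p) ∨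
      (u j < u' j ∧ ∀ p, p ≠ j → u' p ≤ u p)) := by
  have step : ∀ {u u' : Fin 4 → ℤ} {j : Fin 4}, IsGap n F i u → IsGap n F i u' → u' j < u j →
      (∀ p, p ≠ j → u p ≤ u' p) → j ≠ i ∧ ¬ Occurs n c j i := by
    intro u u' j hu hu' hlt hle
    have hji : j ≠ i := by
      rintro rfl
      rw [hu.1, hu'.1] at hlt
      omega
    refine ⟨hji, fun hO => ?_⟩
    have h1 := D.gap_lt_crit hO hu
    have h2 := hu'.2.1 j hji
    have := D.crit_min j (u j - u' j) (u' - u + Pi.single j (u j - u' j)) (by omega)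
      (fun p => by
        rcases eq_or_ne p j with rfl | hp
        · simp
        · simpa [hp] using hle p hp) (by simp)
      (by rw [weight_add, weight_sub, weight_single, hu.2.2, hu'.2.2]; ring)
    omega
  suffices h : ∃ j, ((u' j < u j ∧ ∀ p, p ≠ j → u p ≤ u' p) ∨
      (u j < u' j ∧ ∀ p, p ≠ j → u' p ≤ u p)) by
    obtain ⟨j, hj | hj⟩ := h
    · exact ⟨j, (step hu hu' hj.1 hj.2).1, (step hu hu' hj.1 hj.2).2, .inl hj⟩
    · exact ⟨j, (step hu' hu hj.1 hj.2).1, (step hu' hu hj.1 hj.2).2, .inr hj⟩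
  have hstrict : ∀ {u u' : Fin 4 → ℤ}, weight n u = weight n u' → (∀ p, u p ≤ u' p) → u = u' := by
    intro u u' hw hle
    by_contra hne
    obtain ⟨p, hp⟩ := Function.ne_iff.1 hne
    have : weight n u < weight n u' := by
      refine Finset.sum_lt_sum (fun q _ => mul_le_mul_of_nonneg_right (hle q)
        (Int.natCast_nonneg _)) ⟨p, Finset.mem_univ p, mul_lt_mul_of_pos_right
        (lt_of_le_of_ne (hle p) hp) (by exact_mod_cast D.pos p)⟩
    omega
  have hw : weight n u = weight n u' := hu.2.2.trans hu'.2.2.symm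
  have hi : u i = u' i := hu.1.trans hu'.1.symm
  by_contra! hcon
  obtain ⟨p, hp⟩ : ∃ p, u' p < u p := by
    by_contra! h
    exact hne (hstrict hw h)
  obtain ⟨q, hq⟩ : ∃ q, u q < u' q := by
    by_contra! h
    exact hne (hstrict hw.symm h).symm
  obtain ⟨p', hpp', hp'⟩ := (hcon p).1 hp
  obtain ⟨q', hqq', hq'⟩ := (hcon q).2 hq
  have h1 : p ≠ i := by rintro rfl; omega
  have h2 : p' ≠ i := by rintro rfl; omega
  have h3 : q ≠ i := by rintro rfl; omega
  have h4 : q' ≠ i := by rintro rfl; omega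
  have h5 : p ≠ q := by rintro rfl; omega
  have h6 : p ≠ q' := by rintro rfl; omega
  have h7 : p' ≠ q := by rintro rfl; omega
  have h8 : p' ≠ q' := by rintro rfl; omega
  omega

theorem exists_gap_eq_crit (D : IsSymmetricAbout n F c) {i J : Fin 4} (hJ : J ≠ i)
    (hO : ∀ j, j ≠ i → j ≠ J → Occurs n c j i) :
    ∃ v, IsGap n F i v ∧ v J < c J ∧ ∀ p, p ≠ i → p ≠ J → v p = c p - 1 := by
  classical
  have hex : ∃ t : ℕ, ∃ u, IsGap n F i u ∧ u J = t := by
    obtain ⟨u, hu, -⟩ := D.exists_gap_crit_le hJ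
    exact ⟨(u J).toNat, u, hu, (Int.toNat_of_nonneg (hu.2.1 J hJ)).symm⟩
  obtain ⟨v, hv, hvJ⟩ := Nat.find_spec hex
  have hmin : ∀ u, IsGap n F i u → v J ≤ u J := by
    intro u hu
    have h0 := hu.2.1 J hJ
    have := Nat.find_min' hex ⟨u, hu, (Int.toNat_of_nonneg h0).symm⟩
    omega
  refine ⟨v, hv, ?_, fun p hpi hpJ => ?_⟩
  · by_contra! hle
    obtain ⟨u', hu', hJ0, h⟩ := D.crit_rep J
    have := hmin _ (D.gap_sub_add hv (m := Pi.single J (c J)) (by simp [hJ.symm])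
      (fun p hp => by
        rcases eq_or_ne p J with rfl | hpj
        · simpa using hle
        · simpa [hpj] using hv.2.1 p hp) hu' (by rw [h, weight_single]))
    simp [hJ0] at this
    have := D.crit_pos J
    omega
  · have h1 := D.gap_lt_crit (hO p hpi hpJ) hv
    obtain ⟨u, hu, hup⟩ := D.exists_gap_crit_le hpi
    rcases eq_or_ne u v with rfl | hne
    · omega
    obtain ⟨j, hji, hjO, h⟩ := D.exists_unique_pos_of_gap_ne hu hv hne
    obtain rfl : j = J := by
      by_contra hjJ
      exact hjO (hO j hji hjJ)
    have := hmin u hu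
    rcases h with ⟨-, h⟩ | ⟨h, -⟩
    · have := h p hpJ
      omega
    · omega

end IsSymmetricAbout

theorem IsCutOut.of_injective {k : Type*} [Field k] {n : Fin 4 → ℕ} {f : Fin 4 → Fin 4}
    (hf : f.Injective) (h : IsCutOut k (n ∘ f)) : IsCutOut k n :=
  .of_perm (Equiv.ofBijective f (Finite.injective_iff_bijective.1 hf)) h

namespace IsSymmetricAbout

variable {k : Type*} [Field k] {n : Fin 4 → ℕ} {F : ℤ} {c : Fin 4 → ℤ}

theorem comp_injective (D : IsSymmetricAbout n F c) {f : Fin 4 → Fin 4} (hf : f.Injective) :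
    IsSymmetricAbout (n ∘ f) F (c ∘ f) :=
  D.comp (Equiv.ofBijective f (Finite.injective_iff_bijective.1 hf))

theorem occurs_comp_injective {f : Fin 4 → Fin 4} (hf : f.Injective) {j i : Fin 4} :
    Occurs (n ∘ f) (c ∘ f) j i ↔ Occurs n c (f j) (f i) :=
  occurs_comp (Equiv.ofBijective f (Finite.injective_iff_bijective.1 hf))

theorem sum_ne (D : IsSymmetricAbout n F c) {x y z w : ℤ} (hx : 0 ≤ x) (hy : 0 ≤ y) (hz : 0 ≤ z)
    (hw : 0 ≤ w) : x * n 0 + y * n 1 + z * n 2 + w * n 3 ≠ F := by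
  have := D.weight_ne ![x, y, z, w] (by simp [forall_fin_four, *])
  simpa [weight_eq] using this

theorem isCutOut_of_triangular (D : IsSymmetricAbout n F c) {i j l m : Fin 4}
    (hinj : Function.Injective ![i, j, l, m]) {A B C R S T : ℤ} (hA : 0 ≤ A) (hB : 0 ≤ B)
    (hC : 0 ≤ C) (hR : 0 ≤ R) (hS : 0 ≤ S) (hT : 0 ≤ T) (h₁ : c j * n j = A * n i)
    (h₂ : c l * n l = B * n i + C * n j) (h₃ : c m * n m = R * n i + S * n j + T * n l)
    (hF : -(n i : ℤ) + (c j - 1) * n j + (c l - 1) * n l + (c m - 1) * n m = F) :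
    IsCutOut k n := by
  have E := D.comp_injective hinj
  refine .of_injective hinj ?_
  have hp := D.crit_pos j
  have hq := D.crit_pos l
  have hr := D.crit_pos m
  lift A to ℕ using hA
  lift B to ℕ using hB
  lift C to ℕ using hC
  lift R to ℕ using hR
  lift S to ℕ using hS
  lift T to ℕ using hT
  obtain ⟨p, hp'⟩ := Int.eq_ofNat_of_zero_le hp.le
  obtain ⟨q, hq'⟩ := Int.eq_ofNat_of_zero_le hq.le
  obtain ⟨r, hr'⟩ := Int.eq_ofNat_of_zero_le hr.le
  rw [hp'] at hp h₁ hF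
  rw [hq'] at hq h₂ hF
  rw [hr'] at hr h₃ hF
  exact .of_triangular E.pos (F := F) E.weight_ne (p := p) (q := q) (r := r) (by omega) (by omega)
    (by omega) (A := A) (B := B) (C := C) (D := R) (E := S) (G := T)
    (by exact_mod_cast h₁) (by exact_mod_cast h₂) (by exact_mod_cast h₃) hF

theorem isCutOut_of_occurs_zero (D : IsSymmetricAbout n F c) (h₁ : Occurs n c 1 0)
    (h₂ : Occurs n c 2 0) (h₃ : Occurs n c 3 0) : IsCutOut k n := by
  have hO : ∀ j, j ≠ 0 → Occurs n c j 0 := by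
    simp [forall_fin_four, *]
  obtain ⟨v, hv, -, hvp⟩ := D.exists_gap_eq_crit (i := 0) (J := 1) (by decide)
    fun j hj _ => hO j hj
  obtain ⟨v', hv', hv1⟩ := D.exists_gap_crit_le (i := 0) (j := 1) (by decide)
  obtain rfl : v = v' := by
    by_contra hne
    obtain ⟨j, hj, hjO, -⟩ := D.exists_unique_pos_of_gap_ne hv hv' hne
    exact hjO (hO j hj)
  have hv1' := D.gap_lt_crit h₁ hv
  have e1 : v 1 = c 1 - 1 := by omega
  have e2 := hvp 2 (by decide) (by decide)
  have e3 := hvp 3 (by decide) (by decide)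
  have hF := hv.2.2
  rw [weight_eq, hv.1, e1, e2, e3] at hF
  obtain ⟨-, x, hx, hxw, hx0⟩ := h₁
  obtain ⟨-, y, hy, hyw, hy0⟩ := h₂
  obtain ⟨-, z, hz, hzw, hz0⟩ := h₃
  have x1 := D.eq_zero_of_pos (by decide) hx hxw hx0
  have y2 := D.eq_zero_of_pos (by decide) hy hyw hy0
  have z3 := D.eq_zero_of_pos (by decide) hz hzw hz0
  rw [weight_eq, x1] at hxw
  rw [weight_eq, y2] at hyw
  rw [weight_eq, z3] at hzw
  have c1 := D.crit_pos 1
  have c2 := D.crit_pos 2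
  have c3 := D.crit_pos 3
  rw [forall_fin_four] at hx hy hz
  obtain ⟨-, -, hx2, hx3⟩ := hx
  obtain ⟨-, hy1, -, hy3⟩ := hy
  obtain ⟨-, hz1, hz2, -⟩ := hz
  have h12 : ¬ (0 < x 2 ∧ 0 < y 1) := fun h =>
    D.sum_ne (x := -1 + x 0 + y 0) (y := y 1 - 1) (z := x 2 - 1) (w := c 3 - 1 + x 3 + y 3)
      (by omega) (by omega) (by omega) (by omega) (by linarith)
  have h13 : ¬ (0 < x 3 ∧ 0 < z 1) := fun h =>
    D.sum_ne (x := -1 + x 0 + z 0) (y := z 1 - 1) (z := c 2 - 1 + x 2 + z 2) (w := x 3 - 1)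
      (by omega) (by omega) (by omega) (by omega) (by linarith)
  have h23 : ¬ (0 < y 3 ∧ 0 < z 2) := fun h =>
    D.sum_ne (x := -1 + y 0 + z 0) (y := c 1 - 1 + y 1 + z 1) (z := z 2 - 1) (w := y 3 - 1)
      (by omega) (by omega) (by omega) (by omega) (by linarith)
  have h123 : ¬ (0 < y 1 + z 1 ∧ 0 < x 2 + z 2 ∧ 0 < x 3 + y 3) := fun h =>
    D.sum_ne (x := -1 + x 0 + y 0 + z 0) (y := y 1 + z 1 - 1) (z := x 2 + z 2 - 1)
      (w := x 3 + y 3 - 1) (by omega) (by omega) (by omega) (by omega) (by linarith)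
  have hcases : (x 2 = 0 ∧ x 3 = 0 ∧ y 3 = 0) ∨ (x 2 = 0 ∧ x 3 = 0 ∧ z 2 = 0) ∨
      (y 1 = 0 ∧ y 3 = 0 ∧ x 3 = 0) ∨ (y 1 = 0 ∧ y 3 = 0 ∧ z 1 = 0) ∨
      (z 1 = 0 ∧ z 2 = 0 ∧ x 2 = 0) ∨ (z 1 = 0 ∧ z 2 = 0 ∧ y 1 = 0) := by omega
  rcases hcases with ⟨p, q, r⟩ | ⟨p, q, r⟩ | ⟨p, q, r⟩ | ⟨p, q, r⟩ | ⟨p, q, r⟩ | ⟨p, q, r⟩ <;>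
    simp only [p, q, r, zero_mul, add_zero] at hxw hyw hzw
  · exact D.isCutOut_of_triangular (i := 0) (j := 1) (l := 2) (m := 3) (by decide) hx0.le hy0.le
      hy1 hz0.le hz1 hz2 hxw.symm hyw.symm hzw.symm (by linarith)
  · exact D.isCutOut_of_triangular (i := 0) (j := 1) (l := 3) (m := 2) (by decide) hx0.le hz0.le
      hz1 hy0.le hy1 hy3 hxw.symm hzw.symm hyw.symm (by linarith)
  · exact D.isCutOut_of_triangular (i := 0) (j := 2) (l := 1) (m := 3) (by decide) hy0.le hx0.le
      hx2 hz0.le hz2 hz1 hyw.symm hxw.symm (by linarith) (by linarith)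
  · exact D.isCutOut_of_triangular (i := 0) (j := 2) (l := 3) (m := 1) (by decide) hy0.le hz0.le
      hz2 hx0.le hx2 hx3 hyw.symm hzw.symm (by linarith) (by linarith)
  · exact D.isCutOut_of_triangular (i := 0) (j := 3) (l := 1) (m := 2) (by decide) hz0.le hx0.le
      hx3 hy0.le hy3 hy1 hzw.symm hxw.symm (by linarith) (by linarith)
  · exact D.isCutOut_of_triangular (i := 0) (j := 3) (l := 2) (m := 1) (by decide) hz0.le hy0.le
      hy3 hx0.le hx3 hx2 hzw.symm hyw.symm (by linarith) (by linarith)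

theorem isCutOut_of_forall_occurs (D : IsSymmetricAbout n F c) {i : Fin 4}
    (hO : ∀ j, j ≠ i → Occurs n c j i) : IsCutOut k n := by
  refine .of_perm (Equiv.swap 0 i) ((D.comp _).isCutOut_of_occurs_zero ?_ ?_ ?_) <;>
  · rw [occurs_comp, Equiv.swap_apply_left]
    exact hO _ fun h => by simpa using (Equiv.swap_apply_eq_iff.1 h)

end IsSymmetricAbout

theorem exists_fourth : ∀ {i i' j : Fin 4}, i ≠ i' → i ≠ j → i' ≠ j →
    ∃ p, p ≠ j ∧ p ≠ i ∧ p ≠ i' ∧ ∀ q, q = i ∨ q = i' ∨ q = j ∨ q = p := by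
  decide

namespace IsSymmetricAbout

variable {k : Type*} [Field k] {n : Fin 4 → ℕ} {F : ℤ} {c : Fin 4 → ℤ}

theorem single_nonneg {p : Fin 4} {l : ℤ} (hl : 0 ≤ l) (q : Fin 4) :
    0 ≤ (Pi.single p l : Fin 4 → ℤ) q := by
  rcases eq_or_ne q p with rfl | hq <;> simp [*]

theorem crit_le_of_mul_eq (D : IsSymmetricAbout n F c) {p q : Fin 4} (hpq : p ≠ q) {e l : ℤ}
    (he : 0 < e) (hl : 0 ≤ l) (h : e * n p = l * n q) : c p ≤ e :=
  D.crit_min p e (Pi.single q l) he (single_nonneg hl) (by simp [hpq]) (by rw [weight_single, h])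

theorem pos_of_crit_mul_eq (D : IsSymmetricAbout n F c) {j p : Fin 4} {l : ℤ}
    (h : c j * n j = l * n p) : 0 < l := by
  have hj : (0 : ℤ) < c j * n j := mul_pos (D.crit_pos j) (by exact_mod_cast D.pos j)
  rw [h] at hj
  exact pos_of_mul_pos_left hj (Int.natCast_nonneg _)

/-- If `c j * n j` is a multiple `l * n p` with `c p < l`, then replacing `c p * n p` by any
factorization gives a factorization of `c j * n j` that avoids `j`. -/
theorem occurs_of_crit_lt (D : IsSymmetricAbout n F c) {j p : Fin 4} (hpj : p ≠ j) {l : ℤ}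
    (h : c j * n j = l * n p) (hl : c p < l) {u : Fin 4 → ℤ} (hu : ∀ q, 0 ≤ u q)
    (hw : weight n u = c p * n p) : u j = 0 ∧ ∀ i, i ≠ j → 0 < u i → Occurs n c j i := by
  have hw' : weight n (u + Pi.single p (l - c p)) = c j * n j := by
    rw [weight_add, weight_single, hw, h]
    ring
  have hu' : ∀ q, 0 ≤ (u + Pi.single p (l - c p) : Fin 4 → ℤ) q := fun q =>
    add_nonneg (hu q) (single_nonneg (by omega) q)
  refine ⟨?_, fun i hi hpos => ⟨hi, _, hu', hw', add_pos_of_pos_of_nonneg hpos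
    (single_nonneg (by omega) i)⟩⟩
  have := D.eq_zero_of_pos hpj hu' hw' (by simpa using add_pos_of_nonneg_of_pos (hu p) (by omega))
  simpa [hpj.symm] using this

/-- If two variables `i`, `i'` do not occur for `j`, then `j` and the remaining variable `p` share
a critical degree. -/
theorem crit_mul_eq_of_not_occurs (D : IsSymmetricAbout n F c) {i i' j p : Fin 4} (hi : i ≠ j)
    (hi' : i' ≠ j) (hpj : p ≠ j) (hpi : p ≠ i) (hpi' : p ≠ i')
    (hp : ∀ q, q = i ∨ q = i' ∨ q = j ∨ q = p)
    (hO : ¬ Occurs n c j i) (hO' : ¬ Occurs n c j i') : c j * n j = c p * (n p : ℤ) := by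
  obtain ⟨u, hu, huj, hw⟩ := D.crit_rep j
  have hzero : ∀ {i}, i ≠ j → ¬ Occurs n c j i → u i = 0 := fun {i} hij hO =>
    ((hu i).eq_or_lt.resolve_right fun h => hO ⟨hij, u, hu, hw, h⟩).symm
  have hup : u = Pi.single p (u p) := by
    funext q
    rcases hp q with rfl | rfl | rfl | rfl
    · simp [hpi.symm, hzero hi hO]
    · simp [hpi'.symm, hzero hi' hO']
    · simp [hpj.symm, huj]
    · simp
  rw [hup, weight_single] at hw
  have h0 := D.pos_of_crit_mul_eq hw.symm
  by_contra hne
  have hlt : c p < u p := lt_of_le_of_ne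
    (D.crit_le_of_mul_eq hpj h0 (D.crit_pos j).le hw) fun h => hne (by rw [h, hw])
  obtain ⟨v, hv, hvp, hvw⟩ := D.crit_rep p
  obtain ⟨hvj, hocc⟩ := D.occurs_of_crit_lt hpj hw.symm hlt hv hvw
  have : v = 0 := by
    funext q
    rcases hp q with rfl | rfl | rfl | rfl
    · exact ((hv _).eq_or_lt.resolve_right fun h => hO (hocc _ hi h)).symm
    · exact ((hv _).eq_or_lt.resolve_right fun h => hO' (hocc _ hi' h)).symm
    · exact hvj
    · exact hvp
  have h1 : (0 : ℤ) < c p * n p := mul_pos (D.crit_pos p) (by exact_mod_cast D.pos p)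
  rw [← hvw, this] at h1
  simp [weight] at h1

theorem occurs_or_occurs (D : IsSymmetricAbout n F c)
    (hα : ∀ p j, p ≠ j → c j * n j ≠ c p * (n p : ℤ)) {i i' j : Fin 4} (hii' : i ≠ i')
    (hi : i ≠ j) (hi' : i' ≠ j) : Occurs n c j i ∨ Occurs n c j i' := by
  by_contra! hcon
  obtain ⟨p, hpj, hpi, hpi', hp⟩ := exists_fourth hii' hi hi'
  exact hα p j hpj (D.crit_mul_eq_of_not_occurs hi hi' hpj hpi hpi' hp hcon.1 hcon.2)

theorem crit_mul_ne (D : IsSymmetricAbout n F c)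
    (hα : ∀ p j, p ≠ j → c j * n j ≠ c p * (n p : ℤ)) {i j : Fin 4} (hij : i ≠ j)
    (hO : ¬ Occurs n c j i) {p : Fin 4} (hp : p ≠ j) (l : ℤ) : c j * n j ≠ l * n p := by
  intro h
  have h0 := D.pos_of_crit_mul_eq h
  rcases eq_or_ne p i with rfl | hpi
  · exact hO ⟨hij, Pi.single p l, single_nonneg h0.le, by rw [weight_single, h], by simpa using h0⟩
  have hlt : c p < l := lt_of_le_of_ne
    (D.crit_le_of_mul_eq hp h0 (D.crit_pos j).le h.symm) fun h' => hα p j hp (by rw [h', h])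
  rcases D.occurs_or_occurs hα hij hpi.symm hp.symm with ⟨-, u, hu, hw, hpos⟩ | ⟨-, u, hu, hw, hpos⟩
  · exact hO ((D.occurs_of_crit_lt hp h hlt hu hw).2 i hij hpos)
  · exact hpos.ne' (D.occurs_of_crit_lt hp h hlt hu hw).1

theorem isCutOut_of_four_cycle (D : IsSymmetricAbout n F c)
    (hα : ∀ p j, p ≠ j → c j * n j ≠ c p * (n p : ℤ))
    (h30 : ¬ Occurs n c 3 0) (h01 : ¬ Occurs n c 0 1) (h12 : ¬ Occurs n c 1 2)
    (h23 : ¬ Occurs n c 2 3) (h10 : Occurs n c 1 0) (h20 : Occurs n c 2 0) (h21 : Occurs n c 2 1)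
    (h31 : Occurs n c 3 1) (h02 : Occurs n c 0 2) (h32 : Occurs n c 3 2) (h03 : Occurs n c 0 3)
    (h13 : Occurs n c 1 3) : IsCutOut k n := by
  obtain ⟨u, ⟨hu0, hu, huw⟩, hu3, hup⟩ := D.exists_gap_eq_crit (i := 0) (J := 3) (by decide)
    (by simp [forall_fin_four, *])
  obtain ⟨v, ⟨hv1, hv, hvw⟩, hv0, hvp⟩ := D.exists_gap_eq_crit (i := 1) (J := 0) (by decide)
    (by simp [forall_fin_four, *])
  obtain ⟨x, ⟨hx2, hx, hxw⟩, hx1, hxp⟩ := D.exists_gap_eq_crit (i := 2) (J := 1) (by decide)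
    (by simp [forall_fin_four, *])
  obtain ⟨y, ⟨hy3, hy, hyw⟩, hy2, hyp⟩ := D.exists_gap_eq_crit (i := 3) (J := 2) (by decide)
    (by simp [forall_fin_four, *])
  rw [weight_eq, hu0, hup 1 (by decide) (by decide), hup 2 (by decide) (by decide)] at huw
  rw [weight_eq, hv1, hvp 2 (by decide) (by decide), hvp 3 (by decide) (by decide)] at hvw
  rw [weight_eq, hx2, hxp 0 (by decide) (by decide), hxp 3 (by decide) (by decide)] at hxw
  rw [weight_eq, hy3, hyp 0 (by decide) (by decide), hyp 1 (by decide) (by decide)] at hyw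
  have hu3' := hu 3 (by decide)
  have hv0' := hv 0 (by decide)
  have hx1' := hx 1 (by decide)
  have hy2' := hy 2 (by decide)
  have r0 : c 0 * n 0 = (c 2 - 1 - y 2) * n 2 + (u 3 + 1) * n 3 := by linarith
  have r1 : c 1 * n 1 = (v 0 + 1) * n 0 + (c 3 - 1 - u 3) * n 3 := by linarith
  have r2 : c 2 * n 2 = (c 0 - 1 - v 0) * n 0 + (x 1 + 1) * n 1 := by linarith
  have r3 : c 3 * n 3 = (c 1 - 1 - x 1) * n 1 + (y 2 + 1) * n 2 := by linarith
  have p0 : c 2 - 1 - y 2 ≠ 0 := fun h => D.crit_mul_ne hα (by decide) h01 (p := 3) (by decide)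
    (u 3 + 1) (by rw [r0, h]; ring)
  have p1 : c 3 - 1 - u 3 ≠ 0 := fun h => D.crit_mul_ne hα (by decide) h12 (p := 0) (by decide)
    (v 0 + 1) (by rw [r1, h]; ring)
  have p2 : c 0 - 1 - v 0 ≠ 0 := fun h => D.crit_mul_ne hα (by decide) h23 (p := 1) (by decide)
    (x 1 + 1) (by rw [r2, h]; ring)
  have p3 : c 1 - 1 - x 1 ≠ 0 := fun h => D.crit_mul_ne hα (by decide) h30 (p := 2) (by decide)
    (y 2 + 1) (by rw [r3, h]; ring)
  exact .of_gorenstein D.pos (F := F) D.weight_ne (a := v 0 + 1) (a' := c 0 - 1 - v 0)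
    (b := x 1 + 1) (b' := c 1 - 1 - x 1) (c := c 2 - 1 - y 2) (c' := y 2 + 1) (d := u 3 + 1)
    (d' := c 3 - 1 - u 3) (by omega) (by omega) (by omega) (by omega) (by omega) (by omega)
    (by omega) (by omega) (by linarith) (by linarith) (by linarith) (by linarith)

theorem isCutOut_of_crit_mul_ne (D : IsSymmetricAbout n F c)
    (hα : ∀ p j, p ≠ j → c j * n j ≠ c p * (n p : ℤ))
    (hO : ∀ i, ∃ j, j ≠ i ∧ ¬ Occurs n c j i) : IsCutOut k n := by
  choose μ hμ hμO using hO
  have hinj : ∀ {i i'}, i ≠ i' → μ i ≠ μ i' := by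
    intro i i' hne heq
    rcases D.occurs_or_occurs hα hne (hμ i).symm (heq ▸ (hμ i').symm) with h | h
    · exact hμO i h
    · exact hμO i' (heq ▸ h)
  have hbij : μ.Bijective := Finite.injective_iff_bijective.1 fun i i' h => by
    by_contra hne
    exact hinj hne h
  have hocc : ∀ {i j}, j ≠ i → j ≠ μ i → Occurs n c j i := by
    intro i j hji hj
    obtain ⟨i₀, rfl⟩ := hbij.2 j
    have hne : i ≠ i₀ := fun h => hj (by rw [h])
    exact (D.occurs_or_occurs hα hne hji.symm (hμ i₀).symm).resolve_right (hμO i₀)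
  have hcycle : ∀ i, μ (μ i) ≠ i := by
    intro i hi
    obtain ⟨v, ⟨hvi, hv, hvw⟩, hvj, hvp⟩ := D.exists_gap_eq_crit (hμ i) fun j => hocc
    obtain ⟨w, ⟨hwj, hw, hww⟩, hwi, hwp⟩ := D.exists_gap_eq_crit (i := μ i) (J := i) (hμ i).symm
      fun j h h' => hocc h (by rwa [hi])
    have hdiff : v - w + Pi.single i (w i + 1) - Pi.single (μ i) (v (μ i) + 1) = 0 := by
      funext p
      rcases eq_or_ne p i with rfl | hpi
      · simp [hvi, (hμ p).symm]
        ring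
      rcases eq_or_ne p (μ i) with rfl | hpj
      · simp [hwj, hpi]
      · simp [hpi, hpj, hvp p hpi hpj, hwp p hpj hpi]
    have heq : (w i + 1) * n i = (v (μ i) + 1) * n (μ i) := by
      have := congrArg (weight n) hdiff
      rw [weight_sub, weight_add, weight_sub, weight_single, weight_single, hvw, hww] at this
      simp only [weight, Pi.zero_apply, zero_mul, Finset.sum_const_zero] at this
      linarith
    have h0 := hv _ (hμ i)
    have h1 := hw _ (hμ i).symm
    have h2 := D.crit_le_of_mul_eq (hμ i) (by omega) (by omega) heq.symm
    have h3 : v (μ i) + 1 = c (μ i) := by omega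
    rw [h3] at heq
    exact D.crit_mul_ne hα (hμ i).symm (hμO i) (hμ i).symm _ heq.symm
  generalize ha : μ 0 = a
  generalize hb : μ a = b
  generalize hd : μ b = d
  have a0 : a ≠ 0 := ha ▸ hμ 0
  have ba : b ≠ a := hb ▸ hμ a
  have b0 : b ≠ 0 := by rw [← hb, ← ha]; exact hcycle 0
  have db : d ≠ b := hd ▸ hμ b
  have da : d ≠ a := by rw [← hd, ← hb]; exact hcycle a
  have d0 : d ≠ 0 := by
    rintro rfl
    obtain ⟨x, hx⟩  := exists_fourth a0.symm b0.symm ba.symm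
    have h1 := hinj hx.2.1
    have h2 := hinj hx.2.2.1
    have h3 := hinj hx.1
    rw [ha] at h1
    rw [hb] at h2
    rw [hd] at h3
    rcases hx.2.2.2 (μ x) with h | h | h | h
    exacts [h3 h, h1 h, h2 h, hμ x h]
  have hd0 : μ d = 0 := by
    have h1 := hinj d0
    have h2 := hinj da
    have h3 := hμ d
    rw [ha] at h1
    rw [hb] at h2
    omega
  have hf : Function.Injective ![0, d, b, a] := by
    simp [Function.Injective, forall_fin_four, a0, a0.symm, b0, b0.symm, d0, d0.symm, ba, ba.symm,
      da, da.symm, db, db.symm]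
  refine .of_injective hf ((D.comp_injective hf).isCutOut_of_four_cycle
    (fun p j hpj => hα _ _ (hf.ne hpj)) ?_ ?_ ?_ ?_ ?_ ?_ ?_ ?_ ?_ ?_ ?_ ?_) <;>
  rw [occurs_comp_injective hf]
  · exact ha ▸ hμO 0
  · have := hμO d
    rwa [hd0] at this
  · exact hd ▸ hμO b
  · exact hb ▸ hμO a
  all_goals refine hocc (hf.ne (by decide)) ?_
  · exact (ha ▸ da : d ≠ μ 0)
  · exact (ha ▸ ba : b ≠ μ 0)
  · exact (hd0 ▸ b0 : b ≠ μ d)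
  · exact (hd0 ▸ a0 : a ≠ μ d)
  · exact (hd ▸ d0.symm : 0 ≠ μ b)
  · exact (hd ▸ da.symm : a ≠ μ b)
  · exact (hb ▸ b0.symm : 0 ≠ μ a)
  · exact (hb ▸ db : d ≠ μ a)

end IsSymmetricAbout

/-- The integer `h` lies in the semigroup generated by `p` and `q`. -/
def InSpan (p q h : ℤ) : Prop := ∃ x y : ℤ, 0 ≤ x ∧ 0 ≤ y ∧ h = x * p + y * q

theorem exists_eq_mul_of_mul_eq {p q x y : ℤ} (hp : 0 < p) (hpq : IsCoprime p q)
    (h : p * x = q * y) : ∃ t, x = q * t ∧ y = p * t := by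
  obtain ⟨t, rfl⟩ := hpq.dvd_of_dvd_mul_left (Dvd.intro x h)
  exact ⟨t, mul_left_cancel₀ hp.ne' (by rw [h]; ring), rfl⟩

theorem inSpan_or_inSpan {p q : ℤ} (hq : 0 < q) (hpq : IsCoprime p q) (h : ℤ) :
    InSpan p q h ∨ InSpan p q (p * q - p - q - h) := by
  obtain ⟨a, b, hab⟩ := hpq
  have h0 := Int.emod_nonneg (h * a) hq.ne'
  have h1 := Int.emod_lt_of_pos (h * a) hq
  have h2 := Int.emod_add_mul_ediv (h * a) q
  have key : h = (h * a) % q * p + ((h * a / q) * p + h * b) * q := by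
    linear_combination (-h) * hab - p * h2
  rcases le_or_gt 0 ((h * a / q) * p + h * b) with hy | hy
  · exact .inl ⟨_, _, h0, hy, key⟩
  · refine .inr ⟨q - 1 - (h * a) % q, -1 - ((h * a / q) * p + h * b), by omega, by omega, ?_⟩
    linear_combination (-1) * key

theorem not_inSpan_frobenius {p q : ℤ} (hp : 0 < p) (hq : 0 < q) (hpq : IsCoprime p q) :
    ¬ InSpan p q (p * q - p - q) := by
  rintro ⟨x, y, hx, hy, h⟩
  obtain ⟨t, ht, ht'⟩ := exists_eq_mul_of_mul_eq hp hpq (x := x + 1) (y := p - 1 - y)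
    (by linear_combination (-1) * h)
  have h1 : 0 < t := by
    by_contra! hle
    nlinarith
  nlinarith

theorem inSpan_of_frobenius_lt {p q : ℤ} (hp : 0 < p) (hq : 0 < q) (hpq : IsCoprime p q) {h : ℤ}
    (hlt : p * q - p - q < h) : InSpan p q h := by
  refine (inSpan_or_inSpan hq hpq h).resolve_right ?_
  rintro ⟨x, y, hx, hy, he⟩
  have := mul_nonneg hx hp.le
  have := mul_nonneg hy hq.le
  omega

theorem inSpan_of_gluing {p q r s P Q F h κ : ℤ} (hp : 0 < p) (hq : 0 < q) (hr : 0 < r)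
    (hs : 0 < s) (hpq : IsCoprime p q) (hrs : IsCoprime r s) (hP : 0 < P) (hQ : 0 < Q)
    (hPQ : IsCoprime P Q) (hF : ∀ x y, InSpan p q x → InSpan r s y → F ≠ P * x + Q * y)
    (hκ : F = P * (p * q - p - q) + Q * κ) (hh : InSpan p q h)
    (hhF : F = P * h + Q * (r * s - r - s)) (hle : r * s - r - s ≤ κ) :
    InSpan p q Q ∧ InSpan r s P := by
  obtain ⟨t, ht, ht'⟩ := exists_eq_mul_of_mul_eq hP hPQ (x := h - (p * q - p - q))
    (y := κ - (r * s - r - s)) (by linear_combination hκ - hhF)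
  have ht0 : 0 ≤ t := by
    by_contra! hlt
    nlinarith
  have hne : t ≠ 0 := by
    rintro rfl
    refine not_inSpan_frobenius hp hq hpq ?_
    convert hh using 1
    linear_combination (-1) * ht
  have hlt : t < 2 := by
    by_contra! h2
    refine hF (p * q - p - q + Q) (r * s - r - s + (t - 1) * P)
      (inSpan_of_frobenius_lt hp hq hpq (by omega))
      (inSpan_of_frobenius_lt hr hs hrs (by nlinarith)) ?_
    linear_combination hκ + Q * ht'
  obtain rfl : t = 1 := by omega
  constructor
  · refine (inSpan_or_inSpan hq hpq Q).resolve_right fun h' => ?_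
    refine hF _ (r * s - r - s + 2 * P) h' (inSpan_of_frobenius_lt hr hs hrs (by omega)) ?_
    linear_combination hκ + Q * ht'
  · refine (inSpan_or_inSpan hs hrs P).resolve_right fun h' => ?_
    refine hF (p * q - p - q + 2 * Q) _ (inSpan_of_frobenius_lt hp hq hpq (by omega)) h' ?_
    linear_combination hκ + Q * ht'

namespace IsSymmetricAbout

variable {k : Type*} [Field k] {n : Fin 4 → ℕ} {F : ℤ} {c : Fin 4 → ℤ}

theorem exists_eq_mul_crit (D : IsSymmetricAbout n F c) {i j : Fin 4} (hij : i ≠ j)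
    (h : c i * n i = c j * (n j : ℤ)) :
    ∃ P : ℤ, 0 < P ∧ n i = P * c j ∧ n j = P * c i ∧ IsCoprime (c i) (c j) := by
  obtain ⟨P, a, b, hP, hab, ha, hb⟩ := Nat.exists_coprime' (m := n i) (n := n j)
    (Nat.gcd_pos_of_pos_left _ (D.pos i))
  replace hab := Nat.isCoprime_iff_coprime.2 hab
  replace ha : (n i : ℤ) = P * a := by rw [ha]; push_cast; ring
  replace hb : (n j : ℤ) = P * b := by rw [hb]; push_cast; ring
  generalize (a : ℤ) = a at *
  generalize (b : ℤ) = b at *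
  have hi : (0 : ℤ) < n i := by exact_mod_cast D.pos i
  have hj : (0 : ℤ) < n j := by exact_mod_cast D.pos j
  have hP' : (0 : ℤ) < P := by exact_mod_cast hP
  have ha0 : 0 < a := by
    rw [ha] at hi
    exact pos_of_mul_pos_right hi hP'.le
  have hb0 : 0 < b := by
    rw [hb] at hj
    exact pos_of_mul_pos_right hj hP'.le
  obtain ⟨t, ht, ht'⟩ := exists_eq_mul_of_mul_eq ha0 hab (x := c i) (y := c j)
    (mul_left_cancel₀ hP'.ne' (by linear_combination h - c i * ha + c j * hb))
  have hle := D.crit_le_of_mul_eq hij hb0 ha0.le (by linear_combination b * ha - a * hb)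
  have hci := D.crit_pos i
  have h1 : t = 1 := by
    have : 0 < t := by
      by_contra! hle
      nlinarith
    nlinarith
  subst h1
  rw [mul_one] at ht ht'
  rw [ht, ht']
  exact ⟨P, hP', ha, hb, hab.symm⟩

theorem isCutOut_of_gluing (D : IsSymmetricAbout n F c) (h₁ : c 0 * n 0 = c 1 * (n 1 : ℤ))
    (h₂ : c 2 * n 2 = c 3 * (n 3 : ℤ)) : IsCutOut k n := by
  obtain ⟨P, hP, hn0, hn1, h01⟩ := D.exists_eq_mul_crit (by decide) h₁
  obtain ⟨Q, hQ, hn2, hn3, h23⟩ := D.exists_eq_mul_crit (by decide) h₂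
  have c0 := D.crit_pos 0
  have c1 := D.crit_pos 1
  have c2 := D.crit_pos 2
  have c3 := D.crit_pos 3
  have hPQ : IsCoprime P Q := by
    rw [Int.isCoprime_iff_gcd_eq_one]
    refine D.gcd _ ?_
    have hp := Int.gcd_dvd_left P Q
    have hq := Int.gcd_dvd_right P Q
    rw [forall_fin_four]
    zify
    rw [hn0, hn1, hn2, hn3]
    exact ⟨hp.mul_right _, hp.mul_right _, hq.mul_right _, hq.mul_right _⟩
  have hF : ∀ x y, InSpan (c 1) (c 0) x → InSpan (c 3) (c 2) y → F ≠ P * x + Q * y := by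
    rintro _ _ ⟨x, y, hx, hy, rfl⟩ ⟨z, w, hz, hw, rfl⟩ h
    exact D.sum_ne hx hy hz hw (by rw [hn0, hn1, hn2, hn3, h]; ring)
  have o10 : Occurs n c 1 0 := ⟨by decide, Pi.single 0 (c 0), single_nonneg c0.le,
    by rw [weight_single, h₁], by simpa using c0⟩
  have o32 : Occurs n c 3 2 := ⟨by decide, Pi.single 2 (c 2), single_nonneg c2.le,
    by rw [weight_single, h₂], by simpa using c2⟩
  obtain ⟨u, hu, hu1⟩ := D.exists_gap_crit_le (i := 0) (j := 1) (by decide)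
  have hu1 : u 1 = c 1 - 1 := le_antisymm (by have := D.gap_lt_crit o10 hu; omega) hu1
  obtain ⟨v, hv, hv3⟩ := D.exists_gap_crit_le (i := 2) (j := 3) (by decide)
  have hv3 : v 3 = c 3 - 1 := le_antisymm (by have := D.gap_lt_crit o32 hv; omega) hv3
  obtain ⟨hu0, hu, huw⟩ := hu
  obtain ⟨hv2, hv, hvw⟩ := hv
  rw [weight_eq, hu0, hu1, hn0, hn1, hn2, hn3] at huw
  rw [weight_eq, hv2, hv3, hn0, hn1, hn2, hn3] at hvw
  have hh : InSpan (c 1) (c 0) (v 0 * c 1 + v 1 * c 0) :=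
    ⟨_, _, hv 0 (by decide), hv 1 (by decide), rfl⟩
  have hle : c 3 * c 2 - c 3 - c 2 ≤ u 2 * c 3 + u 3 * c 2 := by
    by_contra! hlt
    have hspan : ∀ m, InSpan (c 1) (c 0) (m * Q) → InSpan (c 3) (c 2) (m * P) := by
      intro m hm
      refine (inSpan_or_inSpan c2 h23.symm _).resolve_right fun h' => ?_
      obtain ⟨x, y, hx, hy, hxy⟩ := hm
      refine hF ((v 0 + x) * c 1 + (v 1 + y) * c 0) _ ⟨_, _, add_nonneg (hv 0 (by decide)) hx,
        add_nonneg (hv 1 (by decide)) hy, rfl⟩ h' ?_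
      linear_combination (-1) * hvw + P * hxy
    obtain ⟨w, hw, hw2⟩ := D.exists_gap_crit_le (i := 0) (j := 2) (by decide)
    have hw1 := D.gap_lt_crit o10 hw
    obtain ⟨hw0, hw, hww⟩ := hw
    have hw3 := hw 3 (by decide)
    rw [weight_eq, hw0, hn0, hn1, hn2, hn3] at hww
    obtain ⟨m, hm, hm'⟩ := exists_eq_mul_of_mul_eq hP hPQ (x := c 0 * (c 1 - 1 - w 1))
      (y := w 2 * c 3 + w 3 * c 2 - (u 2 * c 3 + u 3 * c 2)) (by linear_combination huw - hww)
    rcases (show w 1 ≤ c 1 - 1 by omega).eq_or_lt with he | he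
    · have : m = 0 := by
        rw [he] at hm
        simpa [hQ.ne'] using hm.symm
      subst this
      nlinarith
    · obtain ⟨x, y, hx, hy, hxy⟩ := hspan m ⟨0, c 1 - 1 - w 1, le_rfl, by omega,
        by linear_combination (-1) * hm⟩
      have := D.crit_min 1 (c 1 - 1 - w 1) ![0, 0, x, y] (by omega)
        (by simp [forall_fin_four, *]) (by simp) (by
          simp [weight_eq, hn1, hn2, hn3]
          linear_combination (-P) * hm - Q * hxy)
      have := hw 1 (by decide)
      omega
  obtain ⟨⟨i, j, hi, hj, hij⟩, ⟨a, b, ha, hb, hab⟩⟩ := inSpan_of_gluing c1 c0 c3 c2 h01.symm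
    h23.symm hP hQ hPQ hF (κ := u 2 * c 3 + u 3 * c 2) (by linear_combination (-1) * huw) hh
    (by linear_combination (-1) * hvw) hle
  lift i to ℕ using hi
  lift j to ℕ using hj
  lift a to ℕ using ha
  lift b to ℕ using hb
  obtain ⟨p, hp⟩ := Int.eq_ofNat_of_zero_le c0.le
  obtain ⟨q, hq⟩ := Int.eq_ofNat_of_zero_le c1.le
  obtain ⟨r, hr⟩ := Int.eq_ofNat_of_zero_le c2.le
  obtain ⟨s, hs⟩ := Int.eq_ofNat_of_zero_le c3.le
  refine .of_gluing D.pos (p := p) (q := q) (r := r) (s := s) (i := i) (j := j) (c := a) (d := b)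
    (by omega) (by omega) (by zify; rw [← hp, ← hq, h₁]) (by zify; rw [← hr, ← hs, h₂])
    ?_ ?_ fun x hx => ?_
  · zify
    rw [hn0, hn1, hn2, hn3]
    linear_combination Q * hab - P * hij
  · by_contra! h
    simp [show i = 0 by omega, show j = 0 by omega] at hij
    omega
  · rw [Fin.sum_univ_four, hn0, hn1, hn2, hn3] at hx
    obtain ⟨γ, hγ, hγ'⟩ := exists_eq_mul_of_mul_eq hP hPQ (x := x 0 * c 1 + x 1 * c 0)
      (y := -(x 2 * c 3 + x 3 * c 2)) (by linear_combination hx)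
    obtain ⟨α, hα, hα'⟩ := exists_eq_mul_of_mul_eq c1 h01.symm (x := x 0 - γ * i)
      (y := -(x 1 - γ * j)) (by linear_combination hγ + γ * hij)
    obtain ⟨β, hβ, hβ'⟩ := exists_eq_mul_of_mul_eq c3 h23.symm (x := x 2 + γ * a)
      (y := -(x 3 + γ * b)) (by linear_combination (-1) * hγ' - γ * hab)
    rw [← hp, ← hq, ← hr, ← hs]
    exact ⟨α, β, γ, by linear_combination hα, by linear_combination (-1) * hα',
      by linear_combination hβ, by linear_combination (-1) * hβ'⟩

theorem isCutOut_of_not_occurs (D : IsSymmetricAbout n F c) (h : c 0 * n 0 = c 1 * (n 1 : ℤ))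
    (h20 : ¬ Occurs n c 2 0) (h31 : ¬ Occurs n c 3 1) (h21 : Occurs n c 2 1)
    (h30 : Occurs n c 3 0) : IsCutOut k n := by
  have c0 := D.crit_pos 0
  have c1 := D.crit_pos 1
  have c2 := D.crit_pos 2
  have c3 := D.crit_pos 3
  have o10 : Occurs n c 1 0 := ⟨by decide, Pi.single 0 (c 0), single_nonneg c0.le,
    by rw [weight_single, h], by simpa using c0⟩
  have o01 : Occurs n c 0 1 := ⟨by decide, Pi.single 1 (c 1), single_nonneg c1.le,
    by rw [weight_single, h], by simpa using c1⟩
  obtain ⟨u, ⟨hu0, hu, huw⟩, hu2, hup⟩ := D.exists_gap_eq_crit (i := 0) (J := 2) (by decide)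
    (by simp [forall_fin_four, *])
  obtain ⟨v, ⟨hv1, hv, hvw⟩, hv3, hvp⟩ := D.exists_gap_eq_crit (i := 1) (J := 3) (by decide)
    (by simp [forall_fin_four, *])
  rw [weight_eq, hu0, hup 1 (by decide) (by decide), hup 3 (by decide) (by decide)] at huw
  rw [weight_eq, hv1, hvp 0 (by decide) (by decide), hvp 2 (by decide) (by decide)] at hvw
  have hu2' := hu 2 (by decide)
  have e2 : u 2 = c 2 - 1 := by
    by_contra hne
    have := D.crit_le_of_mul_eq (p := 2) (q := 3) (by decide) (e := c 2 - 1 - u 2)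
      (l := c 3 - 1 - v 3) (by omega) (by omega) (by linarith)
    omega
  rw [e2] at huw
  obtain ⟨-, x, hx, hxw, hx1⟩ := h21
  obtain ⟨-, y, hy, hyw, hy0⟩ := h30
  have x2 := D.eq_zero_of_pos (by decide) hx hxw hx1
  have y3 := D.eq_zero_of_pos (by decide) hy hyw hy0
  have x0 : x 0 = 0 :=
    ((hx 0).eq_or_lt.resolve_right fun h => h20 ⟨by decide, x, hx, hxw, h⟩).symm
  have y1 : y 1 = 0 :=
    ((hy 1).eq_or_lt.resolve_right fun h => h31 ⟨by decide, y, hy, hyw, h⟩).symm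
  rw [weight_eq, x0, x2] at hxw
  rw [weight_eq, y1, y3] at hyw
  rcases (hx 3).eq_or_lt with x3 | x3
  · rw [← x3] at hxw
    exact D.isCutOut_of_triangular (i := 1) (j := 0) (l := 2) (m := 3) (by decide) c1.le hx1.le
      le_rfl le_rfl hy0.le (hy 2) h (by linarith) (by linarith) (by linarith)
  rcases (hy 2).eq_or_lt with y2 | y2
  · rw [← y2] at hyw
    exact D.isCutOut_of_triangular (i := 0) (j := 1) (l := 3) (m := 2) (by decide) c0.le hy0.le
      le_rfl le_rfl hx1.le (hx 3) h.symm (by linarith) (by linarith) (by linarith)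
  exact absurd (by linarith) (D.sum_ne (x := -1 + y 0) (y := c 1 - 1 + x 1) (z := y 2 - 1)
    (w := x 3 - 1) (by omega) (by omega) (by omega) (by omega))

end IsSymmetricAbout

namespace IsSymmetricAbout

variable {k : Type*} [Field k] {n : Fin 4 → ℕ} {F : ℤ} {c : Fin 4 → ℤ}

theorem isCutOut_of_crit_mul_eq (D : IsSymmetricAbout n F c) (h : c 0 * n 0 = c 1 * (n 1 : ℤ))
    (hO₀ : ∃ j, j ≠ 0 ∧ ¬ Occurs n c j 0) (hO₁ : ∃ j, j ≠ 1 ∧ ¬ Occurs n c j 1) :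
    IsCutOut k n := by
  by_cases h23 : c 2 * n 2 = c 3 * (n 3 : ℤ)
  · exact D.isCutOut_of_gluing h h23
  have c0 := D.crit_pos 0
  have c1 := D.crit_pos 1
  have o10 : Occurs n c 1 0 := ⟨by decide, Pi.single 0 (c 0), single_nonneg c0.le,
    by rw [weight_single, h], by simpa using c0⟩
  have o01 : Occurs n c 0 1 := ⟨by decide, Pi.single 1 (c 1), single_nonneg c1.le,
    by rw [weight_single, h], by simpa using c1⟩
  have h2 : Occurs n c 2 0 ∨ Occurs n c 2 1 := by
    by_contra! hcon
    exact h23 (D.crit_mul_eq_of_not_occurs (p := 3) (by decide) (by decide) (by decide) (by decide)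
      (by decide) (by decide) hcon.1 hcon.2)
  have h3 : Occurs n c 3 0 ∨ Occurs n c 3 1 := by
    by_contra! hcon
    exact h23 (D.crit_mul_eq_of_not_occurs (p := 2) (by decide) (by decide) (by decide) (by decide)
      (by decide) (by decide) hcon.1 hcon.2).symm
  have h0 : ¬ Occurs n c 2 0 ∨ ¬ Occurs n c 3 0 := by
    by_contra! hcon
    obtain ⟨j, hj, hjO⟩ := hO₀
    revert j
    simp [forall_fin_four, *]
  have h1 : ¬ Occurs n c 2 1 ∨ ¬ Occurs n c 3 1 := by
    by_contra! hcon
    obtain ⟨j, hj, hjO⟩ := hO₁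
    revert j
    simp [forall_fin_four, *]
  by_cases h20 : Occurs n c 2 0
  · have hf : Function.Injective (![0, 1, 3, 2] : Fin 4 → Fin 4) := by decide
    refine .of_injective hf ((D.comp_injective hf).isCutOut_of_not_occurs h ?_ ?_ ?_ ?_) <;>
      rw [occurs_comp_injective hf] <;> simp <;> tauto
  · exact D.isCutOut_of_not_occurs h h20 (by tauto) (by tauto) (by tauto)

theorem isCutOut (D : IsSymmetricAbout n F c) : IsCutOut k n := by
  by_cases hbox : ∃ i, ∀ j, j ≠ i → Occurs n c j i
  · obtain ⟨i, hi⟩ := hbox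
    exact D.isCutOut_of_forall_occurs hi
  push Not at hbox
  by_cases hα : ∀ p j, p ≠ j → c j * n j ≠ c p * (n p : ℤ)
  · exact D.isCutOut_of_crit_mul_ne hα hbox
  push Not at hα
  obtain ⟨p, j, hpj, h⟩ := hα
  obtain ⟨σ, h0, h1⟩ : ∃ σ : Equiv.Perm (Fin 4), σ 0 = j ∧ σ 1 = p := by
    have hq : Equiv.swap 0 j p ≠ 0 := fun h => hpj (by simpa [Equiv.swap_apply_eq_iff] using h)
    refine ⟨Equiv.swap 0 j * Equiv.swap 1 (Equiv.swap 0 j p), ?_, by simp⟩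
    rw [Equiv.Perm.mul_apply, Equiv.swap_apply_of_ne_of_ne (by decide) hq.symm,
      Equiv.swap_apply_left]
  have transfer : ∀ i, ∃ j, j ≠ i ∧ ¬ Occurs (n ∘ σ) (c ∘ σ) j i := by
    intro i
    obtain ⟨j, hj, hO⟩ := hbox (σ i)
    exact ⟨σ.symm j, fun h => hj (by rw [← h, σ.apply_symm_apply]), by
      rwa [occurs_comp, σ.apply_symm_apply]⟩
  exact .of_perm σ ((D.comp σ).isCutOut_of_crit_mul_eq
    (by simpa only [Function.comp_apply, h0, h1] using h) (transfer 0) (transfer 1))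

end IsSymmetricAbout

theorem mem_closure_range_iff_exists_weight {n : Fin 4 → ℕ} {x : ℕ} :
    x ∈ AddSubmonoid.closure (Set.range n) ↔ ∃ u, (∀ i, 0 ≤ u i) ∧ weight n u = x := by
  constructor
  · intro hx
    induction hx using AddSubmonoid.closure_induction with
    | mem x hx =>
      obtain ⟨i, rfl⟩ := hx
      exact ⟨Pi.single i 1, IsSymmetricAbout.single_nonneg zero_le_one, by simp [weight_single]⟩
    | zero => exact ⟨0, fun _ => le_rfl, by simp [weight]⟩
    | add x y _ _ hx hy =>
      obtain ⟨u, hu, hux⟩ := hx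
      obtain ⟨v, hv, hvy⟩ := hy
      exact ⟨u + v, fun i => add_nonneg (hu i) (hv i), by rw [weight_add, hux, hvy]; push_cast; rfl⟩
  · rintro ⟨u, hu, h⟩
    lift u to Fin 4 → ℕ using hu
    obtain rfl : x = ∑ i, u i • n i := by
      zify
      simpa [weight] using h.symm
    exact sum_mem fun i _ => nsmul_mem (AddSubmonoid.subset_closure (Set.mem_range_self i)) _

theorem exists_isSymmetricAbout {n : Fin 4 → ℕ} (hpos : ∀ i, 0 < n i)
    (hgcd : ∀ d : ℕ, (∀ i, d ∣ n i) → d = 1) {F : ℤ}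
    (hF : ∀ u, (∀ i, 0 ≤ u i) → weight n u ≠ F)
    (hsymm : ∀ m : ℤ, (∃ u, (∀ i, 0 ≤ u i) ∧ weight n u = m) ∨
      ∃ u, (∀ i, 0 ≤ u i) ∧ weight n u = F - m) : ∃ c, IsSymmetricAbout n F c := by
  classical
  have hex : ∀ i, ∃ e : ℕ, 0 < e ∧ ∃ u : Fin 4 → ℤ, (∀ j, 0 ≤ u j) ∧ u i = 0 ∧
      weight n u = e * n i := by
    intro i
    obtain ⟨j, hj⟩ := exists_ne i
    exact ⟨n j, hpos j, Pi.single j (n i), IsSymmetricAbout.single_nonneg (Int.natCast_nonneg _),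
      by simp [hj.symm], by rw [weight_single, mul_comm]⟩
  refine ⟨fun i => Nat.find (hex i), hpos, hgcd, hF, hsymm, fun i => ?_, fun i => ?_,
    fun i e u he hu hi h => ?_⟩
  · exact_mod_cast (Nat.find_spec (hex i)).1
  · exact (Nat.find_spec (hex i)).2
  · lift e to ℕ using he.le
    exact_mod_cast Nat.find_min' (hex i) ⟨by exact_mod_cast he, u, hu, hi, h⟩

/-- **Bresinsky.** Let `n₀ < n₁ < n₂ < n₃` be positive integers with
gcd `1` minimally generating a *symmetric* numerical semigroup `Γ = Γ(n₀,n₁,n₂,n₃)`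
(with Frobenius number `F`, the greatest integer not in `Γ`: symmetry means `F` is
odd and `F − x ∈ Γ` for every `x ∉ Γ`).  Then the defining ideal
`𝔭(n₀,n₁,n₂,n₃) ⊆ k[x₀,x₁,x₂,x₃]` is a set-theoretic complete intersection: there
exist polynomials `f₁, f₂, f₃` with `𝔭(n₀,n₁,n₂,n₃) = √(f₁, f₂, f₃)`. -/
theorem bresinsky_symmetric_dim_four_stci (k : Type*) [Field k] (n : Fin 4 → ℕ)
    (hpos : ∀ i, 0 < n i) (hmono : StrictMono n)
    (hgcd : ∀ d : ℕ, (∀ i, d ∣ n i) → d = 1)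
    (hmin : ∀ i : Fin 4,
      n i ∉ AddSubmonoid.closure {x : ℕ | ∃ j : Fin 4, j ≠ i ∧ x = n j})
    (F : ℕ) (hF : F ∉ AddSubmonoid.closure (Set.range n))
    (hFmax : ∀ x : ℕ, x ∉ AddSubmonoid.closure (Set.range n) → x ≤ F)
    (hFodd : Odd F)
    (hsymm : ∀ x : ℕ, x ∉ AddSubmonoid.closure (Set.range n) →
      F - x ∈ AddSubmonoid.closure (Set.range n)) :
    ∃ f₁ f₂ f₃ : MvPolynomial (Fin 4) k,
      RingHom.ker (MvPolynomial.aeval (R := k) fun i => (X : k[X]) ^ n i).toRingHom =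
        (Ideal.span {f₁, f₂, f₃}).radical := by
  have hmem : ∀ m : ℤ, F < m → ∃ u, (∀ i, 0 ≤ u i) ∧ weight n u = m := by
    intro m hm
    lift m to ℕ using by omega
    rw [← mem_closure_range_iff_exists_weight]
    by_contra h
    have := hFmax m h
    omega
  obtain ⟨c, D⟩ := exists_isSymmetricAbout (F := F) hpos hgcd
    (fun u hu h => hF (mem_closure_range_iff_exists_weight.2 ⟨u, hu, h⟩)) (by
      intro m
      rcases lt_or_ge m 0 with h0 | h0
      · exact .inr (hmem _ (by omega))
      rcases lt_or_ge (F : ℤ) m with h1 | h1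
      · exact .inl (hmem _ h1)
      lift m to ℕ using h0
      by_cases h : m ∈ AddSubmonoid.closure (Set.range n)
      · exact .inl (mem_closure_range_iff_exists_weight.1 h)
      · have := mem_closure_range_iff_exists_weight.1 (hsymm m h)
        rw [Nat.cast_sub (by omega)] at this
        exact .inr this)
  exact D.isCutOut.exists_radical_span hpos hgcd
end
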